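/- arXiv:2208.00869 — 7 statements merged into one kernel-verified Lean document; each statement's English description precedes it below -/
import Mathlib

section
/- Let φ : R → S be a flat homomorphism of commutative rings and let Q be a class of R-modules. If M is a flat Q-Mittag-Leffler R-module, then the S-module M ⊗_R S is a flat (Q ⊗_R S)-Mittag-Leffler S-module, where Q ⊗_R S denotes the class of S-modules {Q ⊗_R S : Q ∈ Q}. -/
open TensorProduct CategoryTheory

universe u

noncomputable section

/-- A module `M` over a commutative ring `A` is *Mittag-Leffler relative to a class `𝒬`*
of `A`-modules if for every family `(Nᵢ)` of modules from `𝒬` the canonical map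
`M ⊗[A] ∏ᵢ Nᵢ → ∏ᵢ (M ⊗[A] Nᵢ)` is injective. -/
def IsRelMittagLeffler (A : Type u) [CommRing A] (M : Type u) [AddCommGroup M] [Module A M]
    (𝒬 : (N : Type u) → [AddCommGroup N] → [Module A N] → Prop) : Prop :=
  ∀ (I : Type u) (N : I → Type u) [∀ i, AddCommGroup (N i)] [∀ i, Module A (N i)],
    (∀ i, 𝒬 (N i)) → Function.Injective (TensorProduct.piRightHom A A M N)

/-- Given a ring map `R → S` (encoded as an `Algebra R S`) and a class `𝒬` of `R`-modules,
`BaseChangeClass R S 𝒬` is the class of `S`-modules of the form `Q ⊗[R] S` (`= S ⊗[R] Q`)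
with `Q ∈ 𝒬`. -/
def BaseChangeClass (R S : Type u) [CommRing R] [CommRing S] [Algebra R S]
    (𝒬 : (N : Type u) → [AddCommGroup N] → [Module R N] → Prop) :
    (N : Type u) → [AddCommGroup N] → [Module S N] → Prop :=
  fun N' _ _ => ∃ (Q : Type u) (_ : AddCommGroup Q) (_ : Module R Q),
    𝒬 Q ∧ Nonempty (N' ≃ₗ[S] S ⊗[R] Q)

/-- An `A`-linear map is a pure monomorphism if it stays injective after tensoring with any
`A`-module. -/
def IsPureMono {A : Type u} [CommRing A] {M N : Type u} [AddCommGroup M] [Module A M]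
    [AddCommGroup N] [Module A N] (f : M →ₗ[A] N) : Prop :=
  ∀ (P : Type u) [AddCommGroup P] [Module A P], Function.Injective (LinearMap.rTensor P f)

/-- A class of `A`-modules is definable if it is closed under isomorphisms, direct products,
direct limits and pure submodules. -/
structure IsDefinableClass (A : Type u) [CommRing A]
    (𝒞 : (N : Type u) → [AddCommGroup N] → [Module A N] → Prop) : Prop where
  closed_iso : ∀ (N₁ : Type u) [AddCommGroup N₁] [Module A N₁]
    (N₂ : Type u) [AddCommGroup N₂] [Module A N₂],
    Nonempty (N₁ ≃ₗ[A] N₂) → 𝒞 N₁ → 𝒞 N₂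
  closed_prod : ∀ (I : Type u) (N : I → Type u) [∀ i, AddCommGroup (N i)]
    [∀ i, Module A (N i)], (∀ i, 𝒞 (N i)) → 𝒞 (∀ i, N i)
  closed_directLimit : ∀ (ι : Type u) [Preorder ι] [IsDirected ι (· ≤ ·)] [DecidableEq ι]
    (G : ι → Type u) [∀ i, AddCommGroup (G i)] [∀ i, Module A (G i)]
    (f : ∀ i j, i ≤ j → G i →ₗ[A] G j), DirectedSystem G (fun i j h => f i j h) →
    (∀ i, 𝒞 (G i)) → 𝒞 (Module.DirectLimit G f)
  closed_pureSubmodule : ∀ (N : Type u) [AddCommGroup N] [Module A N] (p : Submodule A N),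
    IsPureMono p.subtype → 𝒞 N → 𝒞 p

/-- The definable closure `Def(𝒬)` of a class of `A`-modules: the least definable class
containing `𝒬`. -/
def DefClosure (A : Type u) [CommRing A]
    (𝒬 : (N : Type u) → [AddCommGroup N] → [Module A N] → Prop) :
    (N : Type u) → [AddCommGroup N] → [Module A N] → Prop :=
  fun N _ _ => ∀ (𝒞 : (N : Type u) → [AddCommGroup N] → [Module A N] → Prop),
    IsDefinableClass A 𝒞 →
    (∀ (Q : Type u) [AddCommGroup Q] [Module A Q], 𝒬 Q → 𝒞 Q) → 𝒞 N

/-- `Tor₁^A(N, M) = 0`. -/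
def Tor1Vanishes (A : Type u) [CommRing A] (N M : Type u) [AddCommGroup N] [Module A N]
    [AddCommGroup M] [Module A M] : Prop :=
  Subsingleton (((Tor (ModuleCat.{u} A) 1).obj (ModuleCat.of A N)).obj (ModuleCat.of A M))

/-- The class `𝒞^⊺` of all `A`-modules `D` with `Tor₁^A(C, D) = 0` for all `C ∈ 𝒞`. -/
def TorPerp (A : Type u) [CommRing A]
    (𝒞 : (N : Type u) → [AddCommGroup N] → [Module A N] → Prop) :
    (N : Type u) → [AddCommGroup N] → [Module A N] → Prop :=
  fun D _ _ => ∀ (C : Type u) [AddCommGroup C] [Module A C], 𝒞 C → Tor1Vanishes A C D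

/-- `Ext¹_A(M, B) = 0`. -/
def Ext1Vanishes (A : Type u) [CommRing A] (M B : Type u) [AddCommGroup M] [Module A M]
    [AddCommGroup B] [Module A B] : Prop :=
  Subsingleton
    (((Ext A (ModuleCat.{u} A) 1).obj (Opposite.op (ModuleCat.of A M))).obj (ModuleCat.of A B))

/-- The dual definable class `𝒬^∨`: the least definable class containing the character modules
`Q⁺ = Hom_ℤ(Q, ℚ/ℤ)` of all `Q ∈ 𝒬`. -/
def DualDefClass (A : Type u) [CommRing A]
    (𝒬 : (N : Type u) → [AddCommGroup N] → [Module A N] → Prop) :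
    (N : Type u) → [AddCommGroup N] → [Module A N] → Prop :=
  DefClosure A (fun N _ _ => ∃ (Q : Type u) (_ : AddCommGroup Q) (_ : Module A Q),
    𝒬 Q ∧ Nonempty (N ≃ₗ[A] CharacterModule Q))

/-- A module `M` is countably presented if it admits a presentation with countably many
generators and countably many relations. -/
def CountablyPresented (A : Type u) [CommRing A] (M : Type u) [AddCommGroup M]
    [Module A M] : Prop :=
  ∃ (g : (ℕ →₀ A) →ₗ[A] M), Function.Surjective g ∧
    ∃ s : Set (ℕ →₀ A), s.Countable ∧ Submodule.span A s = LinearMap.ker g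

/-- A module `M` is f-projective if it is flat and Mittag-Leffler relative to `{A}`. -/
def IsFProjective (A : Type u) [CommRing A] (M : Type u) [AddCommGroup M] [Module A M] : Prop :=
  Module.Flat A M ∧
    IsRelMittagLeffler A M (fun N _ _ => Nonempty (N ≃ₗ[A] A))

/-- `M` is an FP₂ module: there is an exact sequence `F₂ → F₁ → F₀ → M → 0` with the `Fᵢ`
finitely generated free (equivalently, `M` has a projective resolution whose first three
terms are finitely generated). -/
def IsFP2 (A : Type u) [CommRing A] (M : Type u) [AddCommGroup M] [Module A M] : Prop :=
  ∃ (n₀ n₁ n₂ : ℕ) (f₀ : (Fin n₀ → A) →ₗ[A] M) (f₁ : (Fin n₁ → A) →ₗ[A] (Fin n₀ → A))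
    (f₂ : (Fin n₂ → A) →ₗ[A] (Fin n₁ → A)),
    Function.Surjective f₀ ∧ LinearMap.range f₁ = LinearMap.ker f₀ ∧
      LinearMap.range f₂ = LinearMap.ker f₁

/-- `M` has flat (weak) dimension at most `n`: there is a flat resolution
`0 → F_n → ⋯ → F_0 → M → 0` (formalized as a resolution `F` with `F k = 0` for `k > n`). -/
def FlatDimLE (A : Type u) [CommRing A] (M : Type u) [AddCommGroup M] [Module A M]
    (n : ℕ) : Prop :=
  ∃ (F : ℕ → Type u) (_ : ∀ k, AddCommGroup (F k)) (_ : ∀ k, Module A (F k))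
    (d : ∀ k, F (k + 1) →ₗ[A] F k) (ε : F 0 →ₗ[A] M),
    (∀ k, Module.Flat A (F k)) ∧ (∀ k, n < k → Subsingleton (F k)) ∧
    Function.Surjective ε ∧ LinearMap.ker ε = LinearMap.range (d 0) ∧
    ∀ k, LinearMap.ker (d k) = LinearMap.range (d (k + 1))

/-- `M` has injective dimension at most `n`: there is an injective coresolution
`0 → M → I_0 → ⋯ → I_n → 0` (formalized as a coresolution `I` with `I k = 0` for `k > n`). -/
def InjDimLE (A : Type u) [CommRing A] (M : Type u) [AddCommGroup M] [Module A M]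
    (n : ℕ) : Prop :=
  ∃ (I : ℕ → Type u) (_ : ∀ k, AddCommGroup (I k)) (_ : ∀ k, Module A (I k))
    (d : ∀ k, I k →ₗ[A] I (k + 1)) (ε : M →ₗ[A] I 0),
    (∀ k, Module.Injective A (I k)) ∧ (∀ k, n < k → Subsingleton (I k)) ∧
    Function.Injective ε ∧ LinearMap.range ε = LinearMap.ker (d 0) ∧
    ∀ k, LinearMap.range (d k) = LinearMap.ker (d (k + 1))

/-- `B` is pure-injective: every pure monomorphism `X → Y` induces a surjection
`Hom(Y, B) → Hom(X, B)`. -/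
def IsPureInjective (A : Type u) [CommRing A] (B : Type u) [AddCommGroup B]
    [Module A B] : Prop :=
  ∀ (X Y : Type u) [AddCommGroup X] [Module A X] [AddCommGroup Y] [Module A Y]
    (f : X →ₗ[A] Y), IsPureMono f → ∀ g : X →ₗ[A] B, ∃ h : Y →ₗ[A] B, h ∘ₗ f = g

section FlatRelMittagLeffler

variable {R : Type u} [CommRing R] {M : Type u} [AddCommGroup M] [Module R M]

/-- If `M` is flat and Mittag-Leffler relative to `𝒬`, every finite tuple `m` in `M` factors
as `m k = ∑ j, a k j • v j` so that `a` trivializes every relation `∑ k, m k ⊗ q k = 0` with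
coefficients in a module from `𝒬`. -/
lemma IsRelMittagLeffler.exists_uniform_factorization
    {𝒬 : (N : Type u) → [AddCommGroup N] → [Module R N] → Prop} [Module.Flat R M]
    (hml : IsRelMittagLeffler R M 𝒬) {n : ℕ} (m : Fin n → M) :
    ∃ (p : ℕ) (a : Fin n → Fin p → R) (v : Fin p → M), (∀ k, m k = ∑ j, a k j • v j) ∧
      ∀ (Q : Type u) [AddCommGroup Q] [Module R Q], 𝒬 Q → ∀ q : Fin n → Q,
        ∑ k, m k ⊗ₜ[R] q k = 0 → ∀ j, ∑ k, a k j • q k = 0 := by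
  by_contra! hbad
  let I : Type u := {a : Σ p : ℕ, Fin n → Fin p → R //
    ∃ v : Fin a.1 → M, ∀ k, m k = ∑ j, a.2 k j • v j}
  have hI (a : I) := hbad a.1.1 a.1.2 a.2.choose a.2.choose_spec
  choose Q _ _ hQ q hq j hj using hI
  have hzero : ∑ k, m k ⊗ₜ[R] (fun a : I => q a k) = (0 : M ⊗[R] (∀ a, Q a)) := by
    apply hml I Q hQ
    ext a
    simpa using hq a
  have hzero' : ∑ k, (fun a : I => q a k) ⊗ₜ[R] m k = (0 : (∀ a, Q a) ⊗[R] M) := by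
    simpa using congrArg (TensorProduct.comm R M (∀ a, Q a)) hzero
  obtain ⟨p, a, v, hv, ha⟩ :=
    TensorProduct.vanishesTrivially_of_sum_tmul_eq_zero_of_rTensor_injective R
      (Module.Flat.rTensor_preserves_injective_linearMap _ (Submodule.injective_subtype _)) hzero'
  let a₀ : I := ⟨⟨p, a⟩, v, hv⟩
  apply hj a₀
  simpa using congrFun (ha (j a₀)) a₀

variable {S : Type u} [CommRing S] [Algebra R S]
  {Q : Type u} [AddCommGroup Q] [Module R Q]

/-- If `∑ k, m k ⊗ q k = 0` implies `∑ k, c k • q k = 0` for all tuples `q` in `Q`, then the same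
implication holds for all tuples in `S ⊗ Q`, for `S` flat. -/
lemma sum_smul_eq_zero_of_sum_tmul_eq_zero [Module.Flat R S]
    {n : ℕ} {m : Fin n → M} {c : Fin n → R}
    (hc : ∀ q : Fin n → Q, ∑ k, m k ⊗ₜ[R] q k = 0 → ∑ k, c k • q k = 0)
    (w : Fin n → S ⊗[R] Q) (hw : ∑ k, m k ⊗ₜ[R] w k = 0) : ∑ k, c k • w k = 0 := by
  let f : (Fin n → Q) →ₗ[R] M ⊗[R] Q := LinearMap.lsum R _ R fun k => TensorProduct.mk R M Q (m k)
  let g : (Fin n → Q) →ₗ[R] Q := LinearMap.lsum R _ R fun k => c k • LinearMap.id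
  let w' : S ⊗[R] (Fin n → Q) := ∑ k, (LinearMap.single R (fun _ => Q) k).lTensor S (w k)
  have hf : f.lTensor S w' = 0 := by
    have key (k : Fin n) : f ∘ₗ LinearMap.single R (fun _ => Q) k = TensorProduct.mk R M Q (m k) :=
      LinearMap.ext fun q => by simp [f, LinearMap.lsum_apply, Pi.single_apply, apply_ite]
    have comm (k : Fin n) (z : S ⊗[R] Q) : (TensorProduct.mk R M Q (m k)).lTensor S z =
        TensorProduct.leftComm R M S Q (m k ⊗ₜ z) := by
      induction z with
      | zero => simp
      | tmul s q => simp
      | add x y hx hy => simp [hx, hy, TensorProduct.tmul_add]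
    simp only [w', map_sum, ← LinearMap.lTensor_comp_apply, key, comm]
    rw [← map_sum, hw, map_zero]
  have hg : g.lTensor S w' = ∑ k, c k • w k := by
    have key (k : Fin n) : g ∘ₗ LinearMap.single R (fun _ => Q) k = c k • LinearMap.id :=
      LinearMap.ext fun q => by simp [g, LinearMap.lsum_apply, Pi.single_apply]
    simp [w', map_sum, ← LinearMap.lTensor_comp_apply, key, LinearMap.lTensor_smul]
  obtain ⟨z, hz⟩ := (Module.Flat.lTensor_exact S f.exact_subtype_ker_map w').1 hf
  have hgf : g ∘ₗ f.ker.subtype = 0 := by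
    ext q
    have hq : f q = 0 := q.2
    have hgq : g q = 0 := by
      simpa [g, LinearMap.lsum_apply] using hc q (by simpa [f, LinearMap.lsum_apply] using hq)
    exact hgq
  rw [← hg, ← hz, ← LinearMap.lTensor_comp_apply, hgf, LinearMap.lTensor_zero,
    LinearMap.zero_apply]

/-- Every element of `(S ⊗[R] M) ⊗[S] X` is a finite sum of tensors `(1 ⊗ m) ⊗ y`. -/
lemma exists_eq_sum_one_tmul_tmul {X : Type u} [AddCommGroup X] [Module S X]
    (x : (S ⊗[R] M) ⊗[S] X) :
    ∃ (n : ℕ) (m : Fin n → M) (y : Fin n → X), x = ∑ k, ((1 : S) ⊗ₜ[R] m k) ⊗ₜ[S] y k := by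
  induction x with
  | zero => exact ⟨0, Fin.elim0, Fin.elim0, by simp⟩
  | tmul t y =>
    induction t with
    | zero => exact ⟨0, Fin.elim0, Fin.elim0, by simp⟩
    | tmul s m =>
      refine ⟨1, fun _ => m, fun _ => s • y, ?_⟩
      simp [TensorProduct.smul_tmul']
    | add t₁ t₂ h₁ h₂ =>
      obtain ⟨n₁, m₁, y₁, h₁⟩ := h₁
      obtain ⟨n₂, m₂, y₂, h₂⟩ := h₂
      exact ⟨n₁ + n₂, Fin.append m₁ m₂, Fin.append y₁ y₂, by
        simp [Fin.sum_univ_add, TensorProduct.add_tmul, h₁, h₂]⟩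
  | add x₁ x₂ h₁ h₂ =>
    obtain ⟨n₁, m₁, y₁, h₁⟩ := h₁
    obtain ⟨n₂, m₂, y₂, h₂⟩ := h₂
    exact ⟨n₁ + n₂, Fin.append m₁ m₂, Fin.append y₁ y₂, by simp [Fin.sum_univ_add, h₁, h₂]⟩

end FlatRelMittagLeffler

/-- Let `φ : R → S` be a flat homomorphism of commutative rings and `𝒬` a class
of `R`-modules. If `M` is a flat `𝒬`-Mittag-Leffler `R`-module, then the `S`-module `M ⊗[R] S`
is a flat `(𝒬 ⊗[R] S)`-Mittag-Leffler `S`-module. -/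
theorem stmt_0 (R S : Type u) [CommRing R] [CommRing S] [Algebra R S] [Module.Flat R S]
    (𝒬 : (N : Type u) → [AddCommGroup N] → [Module R N] → Prop)
    (M : Type u) [AddCommGroup M] [Module R M]
    (hflat : Module.Flat R M) (hml : IsRelMittagLeffler R M 𝒬) :
    Module.Flat S (S ⊗[R] M) ∧
      IsRelMittagLeffler S (S ⊗[R] M) (BaseChangeClass R S 𝒬) := by
  refine ⟨inferInstance, fun I N _ _ hN => (injective_iff_map_eq_zero _).2 fun x hx => ?_⟩
  obtain ⟨n, m, y, rfl⟩ := exists_eq_sum_one_tmul_tmul x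
  obtain ⟨p, a, v, hv, ha⟩ := hml.exists_uniform_factorization m
  have hy (j : Fin p) : ∑ k, algebraMap R S (a k j) • y k = 0 := by
    ext i
    obtain ⟨Q, _, _, hQ, ⟨e⟩⟩ := hN i
    have hi : ∑ k, ((1 : S) ⊗ₜ[R] m k) ⊗ₜ[S] y k i = 0 := by simpa using congrFun hx i
    have hi' : ∑ k, m k ⊗ₜ[R] e (y k i) = 0 := by
      simpa using congrArg (TensorProduct.comm R _ _ ∘
        TensorProduct.AlgebraTensorModule.cancelBaseChange R S S (S ⊗[R] Q) M ∘
        TensorProduct.comm S _ _ ∘ e.toLinearMap.lTensor (S ⊗[R] M)) hi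
    apply e.injective
    simpa using sum_smul_eq_zero_of_sum_tmul_eq_zero (fun q hq => ha Q hQ q hq j) _ hi'
  calc ∑ k, ((1 : S) ⊗ₜ[R] m k) ⊗ₜ[S] y k
      = ∑ k, ∑ j, ((1 : S) ⊗ₜ[R] v j) ⊗ₜ[S] (algebraMap R S (a k j) • y k) := by
        refine Finset.sum_congr rfl fun k _ => ?_
        rw [hv k, TensorProduct.tmul_sum, TensorProduct.sum_tmul]
        refine Finset.sum_congr rfl fun j _ => ?_
        rw [TensorProduct.tmul_smul, ← algebraMap_smul S, TensorProduct.smul_tmul]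
    _ = ∑ j, ((1 : S) ⊗ₜ[R] v j) ⊗ₜ[S] ∑ k, algebraMap R S (a k j) • y k := by
        rw [Finset.sum_comm]
        simp only [TensorProduct.tmul_sum]
    _ = 0 := by simp [hy]

end
end

section
/- Let φ : R → S be a faithfully flat homomorphism of commutative rings and let Q be a class of R-modules. If M is an R-module such that M ⊗_R S is a flat (Q ⊗_R S)-Mittag-Leffler S-module, then M is a flat Q-Mittag-Leffler R-module. -/
open TensorProduct CategoryTheory

universe u

noncomputable section

/-- The map `M ⊗[R] X → (S ⊗[R] M) ⊗[S] X`, `m ⊗ x ↦ (1 ⊗ m) ⊗ x`, as an isomorphism of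
`R`-modules, for an `S`-module `X`. -/
def tensorEquivBaseChangeTensor (R S M X : Type*) [CommRing R] [CommRing S] [Algebra R S]
    [AddCommGroup M] [Module R M] [AddCommGroup X] [Module R X] [Module S X]
    [IsScalarTower R S X] : M ⊗[R] X ≃ₗ[R] (S ⊗[R] M) ⊗[S] X :=
  TensorProduct.comm R M X ≪≫ₗ
    ((AlgebraTensorModule.cancelBaseChange R S S X M).symm ≪≫ₗ
      TensorProduct.comm S X (S ⊗[R] M)).restrictScalars R

@[simp]
lemma tensorEquivBaseChangeTensor_tmul {R S M X : Type*} [CommRing R] [CommRing S] [Algebra R S]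
    [AddCommGroup M] [Module R M] [AddCommGroup X] [Module R X] [Module S X]
    [IsScalarTower R S X] (m : M) (x : X) :
    tensorEquivBaseChangeTensor R S M X (m ⊗ₜ x) = ((1 : S) ⊗ₜ[R] m) ⊗ₜ[S] x := by
  simp [tensorEquivBaseChangeTensor]

/-- Relative Mittag-Leffler flat modules descend along faithfully flat ring maps: for `M` flat,
injectivity of `M ⊗[R] ∏ᵢ Nᵢ → ∏ᵢ (M ⊗[R] Nᵢ)` can be checked after base change. -/
lemma piRightHom_injective_of_baseChange {R S M I : Type*} [CommRing R] [CommRing S] [Algebra R S]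
    [Module.FaithfullyFlat R S] [AddCommGroup M] [Module R M] [Module.Flat R M]
    (N : I → Type*) [∀ i, AddCommGroup (N i)] [∀ i, Module R (N i)]
    (h : Function.Injective (piRightHom S S (S ⊗[R] M) fun i ↦ S ⊗[R] N i)) :
    Function.Injective (piRightHom R R M N) := by
  let ι : (∀ i, N i) →ₗ[R] ∀ i, S ⊗[R] N i :=
    LinearMap.pi fun i ↦ TensorProduct.mk R S (N i) 1 ∘ₗ LinearMap.proj i
  have hι : Function.Injective ι := fun x y hxy ↦ funext fun i ↦
    Module.FaithfullyFlat.tensorProduct_mk_injective (B := S) (N i) (congrFun hxy i)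
  let e := tensorEquivBaseChangeTensor R S M (∀ i, S ⊗[R] N i)
  let g : (∀ i, M ⊗[R] N i) →ₗ[R] ∀ i, (S ⊗[R] M) ⊗[S] (S ⊗[R] N i) :=
    LinearMap.pi fun i ↦ (tensorEquivBaseChangeTensor R S M (S ⊗[R] N i)).toLinearMap ∘ₗ
      (TensorProduct.mk R S (N i) 1).lTensor M ∘ₗ LinearMap.proj i
  have hcomm : g ∘ₗ piRightHom R R M N =
      (piRightHom S S (S ⊗[R] M) fun i ↦ S ⊗[R] N i).restrictScalars R ∘ₗ
        e.toLinearMap ∘ₗ ι.lTensor M := by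
    ext m x i
    simp [g, e, ι]
  refine Function.Injective.of_comp (f := g) ?_
  rw [← LinearMap.coe_comp, hcomm]
  exact h.comp (e.injective.comp (Module.Flat.lTensor_preserves_injective_linearMap ι hι))

/-- Let `φ : R → S` be a faithfully flat homomorphism of commutative rings and
`𝒬` a class of `R`-modules. If `M ⊗[R] S` is a flat `(𝒬 ⊗[R] S)`-Mittag-Leffler `S`-module,
then `M` is a flat `𝒬`-Mittag-Leffler `R`-module. -/
theorem stmt_1 (R S : Type u) [CommRing R] [CommRing S] [Algebra R S] [Module.FaithfullyFlat R S]
    (𝒬 : (N : Type u) → [AddCommGroup N] → [Module R N] → Prop)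
    (M : Type u) [AddCommGroup M] [Module R M]
    (hflat : Module.Flat S (S ⊗[R] M))
    (hml : IsRelMittagLeffler S (S ⊗[R] M) (BaseChangeClass R S 𝒬)) :
    Module.Flat R M ∧ IsRelMittagLeffler R M 𝒬 := by
  have : Module.Flat R M := Module.Flat.of_flat_tensorProduct R M S
  refine ⟨this, fun I N _ _ hN ↦ piRightHom_injective_of_baseChange (S := S) N ?_⟩
  exact hml I _ fun i ↦ ⟨N i, inferInstance, inferInstance, hN i, ⟨LinearEquiv.refl S _⟩⟩

end
end

section
/- Let φ : R → S be a homomorphism of commutative rings which is a pure monomorphism when viewed as a map of R-modules, and let Q be a class of R-modules. If M is a flat R-module such that M ⊗_R S is a (Q ⊗_R S)-Mittag-Leffler S-module, then M is a Q-Mittag-Leffler R-module. -/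
open TensorProduct CategoryTheory

universe u

noncomputable section

/-- If `φ : R → S` is pure over `R`, then `Q → S ⊗[R] Q`, `q ↦ 1 ⊗ q`, is injective. -/
theorem IsPureMono.injective_one_tmul {R S : Type u} [CommRing R] [CommRing S] [Algebra R S]
    (hpure : IsPureMono (Algebra.linearMap R S)) (Q : Type u) [AddCommGroup Q] [Module R Q] :
    Function.Injective (TensorProduct.mk R S Q 1) := by
  have h : TensorProduct.mk R S Q 1 =
      LinearMap.rTensor Q (Algebra.linearMap R S) ∘ₗ (TensorProduct.lid R Q).symm.toLinearMap := by
    ext q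
    simp
  rw [h]
  exact (hpure Q).comp (TensorProduct.lid R Q).symm.injective

/-- For an `S`-module `P`, the canonical isomorphism `M ⊗[R] P ≃ (S ⊗[R] M) ⊗[S] P`. -/
def tensorBaseChangeEquiv (R S M P : Type u) [CommRing R] [CommRing S] [Algebra R S]
    [AddCommGroup M] [Module R M] [AddCommGroup P] [Module R P] [Module S P]
    [IsScalarTower R S P] : M ⊗[R] P ≃ₗ[R] (S ⊗[R] M) ⊗[S] P :=
  TensorProduct.comm R M P ≪≫ₗ
    ((AlgebraTensorModule.cancelBaseChange R S S P M).symm ≪≫ₗ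
      TensorProduct.comm S P (S ⊗[R] M)).restrictScalars R

theorem tensorBaseChangeEquiv_tmul (R S M P : Type u) [CommRing R] [CommRing S] [Algebra R S]
    [AddCommGroup M] [Module R M] [AddCommGroup P] [Module R P] [Module S P]
    [IsScalarTower R S P] (m : M) (p : P) :
    tensorBaseChangeEquiv R S M P (m ⊗ₜ p) = ((1 : S) ⊗ₜ[R] m) ⊗ₜ[S] p := by
  simp [tensorBaseChangeEquiv]

/-- Let `φ : R → S` be a homomorphism of commutative rings which is a pure
monomorphism as a map of `R`-modules, and `𝒬` a class of `R`-modules. If `M` is a flat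
`R`-module such that `M ⊗[R] S` is a `(𝒬 ⊗[R] S)`-Mittag-Leffler `S`-module, then `M` is a
`𝒬`-Mittag-Leffler `R`-module. -/
theorem stmt_2 (R S : Type u) [CommRing R] [CommRing S] [Algebra R S]
    (hpure : IsPureMono (Algebra.linearMap R S))
    (𝒬 : (N : Type u) → [AddCommGroup N] → [Module R N] → Prop)
    (M : Type u) [AddCommGroup M] [Module R M] (hflat : Module.Flat R M)
    (hml : IsRelMittagLeffler S (S ⊗[R] M) (BaseChangeClass R S 𝒬)) :
    IsRelMittagLeffler R M 𝒬 := by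
  intro I N _ _ hN
  let J : (∀ i, N i) →ₗ[R] (∀ i, S ⊗[R] N i) :=
    LinearMap.pi fun i => TensorProduct.mk R S (N i) 1 ∘ₗ LinearMap.proj i
  have hJ : Function.Injective J := fun x y hxy =>
    funext fun i => hpure.injective_one_tmul (N i) (congrFun hxy i)
  have hinj : Function.Injective fun x : M ⊗[R] (∀ i, N i) =>
      TensorProduct.piRightHom S S (S ⊗[R] M) (fun i => S ⊗[R] N i)
        (tensorBaseChangeEquiv R S M (∀ i, S ⊗[R] N i) (LinearMap.lTensor M J x)) :=
    (hml I (fun i => S ⊗[R] N i)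
      fun i => ⟨N i, inferInstance, inferInstance, hN i, ⟨LinearEquiv.refl S _⟩⟩).comp
      ((tensorBaseChangeEquiv R S M _).injective.comp
        (Module.Flat.lTensor_preserves_injective_linearMap J hJ))
  have hcomm : ∀ (x : M ⊗[R] (∀ i, N i)) (i : I),
      TensorProduct.piRightHom S S (S ⊗[R] M) (fun i => S ⊗[R] N i)
        (tensorBaseChangeEquiv R S M (∀ i, S ⊗[R] N i) (LinearMap.lTensor M J x)) i =
      tensorBaseChangeEquiv R S M (S ⊗[R] N i)
        (LinearMap.lTensor M (TensorProduct.mk R S (N i) 1)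
          (TensorProduct.piRightHom R R M N x i)) := by
    intro x i
    induction x with
    | zero => simp
    | tmul m n => simp [tensorBaseChangeEquiv_tmul, J]
    | add x y hx hy => simp only [map_add, Pi.add_apply, hx, hy]
  intro x y hxy
  apply hinj
  funext i
  simp only [hcomm, hxy]

end
end

section
/- Let R be a ring, Q a class of left R-modules, and M a right R-module. If M is Q-Mittag-Leffler, then M is Def(Q)-Mittag-Leffler, where Def(Q) is the definable closure of Q, i.e., the least class of left R-modules containing Q that is closed under direct products, direct limits, and pure submodules. -/
open TensorProduct CategoryTheory

universe u

noncomputable section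

section MittagLeffler

variable {R : Type u} [CommRing R]

/-- For a free module, the comparison map from the tensor product with a product to the product
of the tensor products is injective. -/
lemma piRightHom_finsupp_injective (X : Type u) {I : Type u} (N : I → Type u)
    [∀ i, AddCommGroup (N i)] [∀ i, Module R (N i)] :
    Function.Injective (TensorProduct.piRightHom R R (X →₀ R) N) := by
  classical
  intro s t h
  have key (x : X) (i : I) (s : (X →₀ R) ⊗[R] (∀ i, N i)) :
      TensorProduct.finsuppScalarLeft R (∀ i, N i) X s x i =
        TensorProduct.finsuppScalarLeft R (N i) X
          (TensorProduct.piRightHom R R (X →₀ R) N s i) x := by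
    induction s with
    | zero => simp
    | tmul p n => simp [TensorProduct.finsuppScalarLeft_apply_tmul_apply]
    | add a b ha hb => simp [ha, hb]
  apply (TensorProduct.finsuppScalarLeft R (∀ i, N i) X).injective
  ext x i
  rw [key, key, h]

lemma piRightHom_rTensor {P P' : Type u} [AddCommGroup P] [Module R P] [AddCommGroup P']
    [Module R P'] (g : P →ₗ[R] P') {I : Type u} (N : I → Type u)
    [∀ i, AddCommGroup (N i)] [∀ i, Module R (N i)] (s : P ⊗[R] (∀ i, N i)) (i : I) :
    TensorProduct.piRightHom R R P' N (g.rTensor _ s) i =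
      g.rTensor (N i) (TensorProduct.piRightHom R R P N s i) := by
  induction s with
  | zero => simp
  | tmul p n => simp
  | add a b ha hb => simp [ha, hb]

lemma exists_subtype_rTensor_eq {P P' N : Type u} [AddCommGroup P] [Module R P]
    [AddCommGroup P'] [Module R P'] [AddCommGroup N] [Module R N] {g : P →ₗ[R] P'}
    (hg : Function.Surjective g) {t : P ⊗[R] N} (ht : g.rTensor N t = 0) :
    ∃ z, (LinearMap.ker g).subtype.rTensor N z = t :=
  (rTensor_exact N g.exact_subtype_ker_map hg t).1 ht

lemma exists_sum_tmul_eq_of_mkQ_rTensor_eq_zero {P N : Type u} [AddCommGroup P] [Module R P]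
    [AddCommGroup N] [Module R N] {k : ℕ} (c : Fin k → P) {t : P ⊗[R] N}
    (ht : (Submodule.span R (Set.range c)).mkQ.rTensor N t = 0) :
    ∃ y : Fin k → N, t = ∑ j, c j ⊗ₜ[R] y j := by
  obtain ⟨z, rfl⟩ := exists_subtype_rTensor_eq (Submodule.mkQ_surjective _) ht
  clear ht
  induction z with
  | zero => exact ⟨0, by simp⟩
  | tmul d n =>
    obtain ⟨a, ha⟩ := (Submodule.mem_span_range_iff_exists_fun R).1
      ((Submodule.Quotient.mk_eq_zero (Submodule.span R (Set.range c))).1 d.2)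
    exact ⟨fun j => a j • n, by simp [← ha, TensorProduct.sum_tmul, TensorProduct.smul_tmul]⟩
  | add a b ha hb =>
    obtain ⟨y, hy⟩ := ha
    obtain ⟨y', hy'⟩ := hb
    exact ⟨y + y', by simp [hy, hy', TensorProduct.tmul_add, Finset.sum_add_distrib]⟩

lemma mkQ_rTensor_sum_tmul {P N : Type u} [AddCommGroup P] [Module R P]
    [AddCommGroup N] [Module R N] {k : ℕ} (c : Fin k → P) (y : Fin k → N) :
    (Submodule.span R (Set.range c)).mkQ.rTensor N (∑ j, c j ⊗ₜ[R] y j) = 0 := by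
  rw [map_sum]
  refine Finset.sum_eq_zero fun j _ => ?_
  have hj : c j ∈ Submodule.span R (Set.range c) := Submodule.subset_span ⟨j, rfl⟩
  rw [LinearMap.rTensor_tmul, Submodule.mkQ_apply, (Submodule.Quotient.mk_eq_zero _).2 hj,
    TensorProduct.zero_tmul]

/-- A quotient of a free module by a finitely generated submodule is Mittag-Leffler. -/
lemma piRightHom_finsupp_quotient_injective {X : Type u} {K : Submodule R (X →₀ R)} (hK : K.FG)
    {I : Type u} (N : I → Type u) [∀ i, AddCommGroup (N i)] [∀ i, Module R (N i)] :
    Function.Injective (TensorProduct.piRightHom R R ((X →₀ R) ⧸ K) N) := by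
  rw [injective_iff_map_eq_zero]
  intro t ht
  obtain ⟨s, rfl⟩ := LinearMap.rTensor_surjective (∀ i, N i) K.mkQ_surjective t
  obtain ⟨k, c, rfl⟩ := Submodule.fg_iff_exists_fin_generating_family.1 hK
  have hs (i : I) : ∃ y : Fin k → N i,
      TensorProduct.piRightHom R R (X →₀ R) N s i = ∑ j, c j ⊗ₜ[R] y j := by
    apply exists_sum_tmul_eq_of_mkQ_rTensor_eq_zero
    rw [← piRightHom_rTensor, ht, Pi.zero_apply]
  choose y hy using hs
  have hsum : s = ∑ j, c j ⊗ₜ[R] fun i => y i j := by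
    apply piRightHom_finsupp_injective
    ext i
    rw [hy]
    simp [Finset.sum_apply]
  rw [hsum, mkQ_rTensor_sum_tmul]

variable {M : Type u}

/-- The tensor `∑ᵢ eᵢ ⊗ qᵢ` in `((M →₀ R) ⧸ K) ⊗ N`, where `eᵢ` is the class of the basis vector
at `mᵢ`; for `K` contained in the kernel of `(M →₀ R) → M` it is a lift of `∑ᵢ mᵢ ⊗ qᵢ`. -/
def liftedTensor (K : Submodule R (M →₀ R)) {N : Type u} [AddCommGroup N] [Module R N]
    {n : ℕ} (m : Fin n → M) (q : Fin n → N) : ((M →₀ R) ⧸ K) ⊗[R] N :=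
  ∑ i, K.mkQ (Finsupp.single (m i) 1) ⊗ₜ[R] q i

lemma lTensor_liftedTensor (K : Submodule R (M →₀ R)) {N N' : Type u} [AddCommGroup N]
    [Module R N] [AddCommGroup N'] [Module R N'] (f : N →ₗ[R] N') {n : ℕ} (m : Fin n → M)
    (q : Fin n → N) :
    f.lTensor _ (liftedTensor K m q) = liftedTensor K m (fun i => f (q i)) := by
  simp [liftedTensor]

lemma piRightHom_liftedTensor (K : Submodule R (M →₀ R)) {I : Type u} (N : I → Type u)
    [∀ i, AddCommGroup (N i)] [∀ i, Module R (N i)] {n : ℕ} (m : Fin n → M)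
    (q : Fin n → ∀ i, N i) (i : I) :
    TensorProduct.piRightHom R R _ N (liftedTensor K m q) i =
      liftedTensor K m (fun j => q j i) := by
  simp [liftedTensor, Finset.sum_apply]

variable [AddCommGroup M] [Module R M]

lemma sum_tmul_eq_zero_of_liftedTensor_eq_zero {K : Submodule R (M →₀ R)}
    (hK : K ≤ LinearMap.ker (Finsupp.linearCombination R (id : M → M)))
    {N : Type u} [AddCommGroup N] [Module R N] {n : ℕ} {m : Fin n → M} {q : Fin n → N}
    (h : liftedTensor K m q = 0) : ∑ i, m i ⊗ₜ[R] q i = 0 := by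
  simpa [liftedTensor] using congrArg ((K.liftQ _ hK).rTensor N) h

lemma exists_liftedTensor_eq_zero {N : Type u} [AddCommGroup N] [Module R N] {n : ℕ}
    {m : Fin n → M} {q : Fin n → N} (h : ∑ i, m i ⊗ₜ[R] q i = 0) :
    ∃ K : Submodule R (M →₀ R), K.FG ∧
      K ≤ LinearMap.ker (Finsupp.linearCombination R (id : M → M)) ∧
      liftedTensor K m q = 0 := by
  have hsurj : Function.Surjective (Finsupp.linearCombination R (id : M → M)) :=
    fun x => ⟨Finsupp.single x 1, by simp⟩
  have h0 : (Finsupp.linearCombination R (id : M → M)).rTensor N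
      (∑ i, Finsupp.single (m i) 1 ⊗ₜ[R] q i) = 0 := by simpa using h
  obtain ⟨z, hz⟩ := exists_subtype_rTensor_eq hsurj h0
  obtain ⟨k, c, y, rfl⟩ := TensorProduct.exists_sum_tmul_eq z
  refine ⟨Submodule.span R (Set.range fun j => (c j : M →₀ R)),
    Submodule.fg_span (Set.finite_range _), ?_, ?_⟩
  · rw [Submodule.span_le]
    rintro _ ⟨j, rfl⟩
    exact (c j).2
  · have h1 := mkQ_rTensor_sum_tmul (R := R) (fun j => (c j : M →₀ R)) y
    simp only [map_sum, LinearMap.rTensor_tmul, Submodule.subtype_apply] at hz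
    rw [hz] at h1
    simpa only [liftedTensor, map_sum, LinearMap.rTensor_tmul] using h1

/-- If `M` is `𝒬`-Mittag-Leffler, then the vanishing of tensors `∑ᵢ mᵢ ⊗ qᵢ` with entries in
modules from `𝒬` is witnessed by a single finitely generated module of relations. -/
lemma IsRelMittagLeffler.exists_uniform_relations
    {𝒬 : (N : Type u) → [AddCommGroup N] → [Module R N] → Prop}
    (hml : IsRelMittagLeffler R M 𝒬) {n : ℕ} (m : Fin n → M) :
    ∃ K : Submodule R (M →₀ R), K.FG ∧
      K ≤ LinearMap.ker (Finsupp.linearCombination R (id : M → M)) ∧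
      ∀ (N : Type u) [AddCommGroup N] [Module R N], 𝒬 N → ∀ q : Fin n → N,
        ∑ i, m i ⊗ₜ[R] q i = 0 → liftedTensor K m q = 0 := by
  by_contra! hcon
  let I : Type u := {K : Submodule R (M →₀ R) // K.FG ∧
    K ≤ LinearMap.ker (Finsupp.linearCombination R (id : M → M))}
  choose N hgrp hmod hN q hq hne using fun K : I => hcon K.1 K.2.1 K.2.2
  have hzero : ∑ i, m i ⊗ₜ[R] (fun K => q K i) = (0 : M ⊗[R] ∀ K, N K) := by
    apply hml I N hN
    ext K
    simpa [Finset.sum_apply] using hq K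
  obtain ⟨K, hfg, hle, hK⟩ := exists_liftedTensor_eq_zero hzero
  apply hne ⟨K, hfg, hle⟩
  rw [← piRightHom_liftedTensor K N m (fun i K => q K i) ⟨K, hfg, hle⟩, hK]
  simp

/-- The modules `N` over which the vanishing of any tensor `∑ᵢ mᵢ ⊗ qᵢ` in `M ⊗ N` is witnessed
by the relations in `K m`. -/
def UniformRelations (K : ∀ {n : ℕ}, (Fin n → M) → Submodule R (M →₀ R)) :
    (N : Type u) → [AddCommGroup N] → [Module R N] → Prop :=
  fun N _ _ => ∀ (n : ℕ) (m : Fin n → M) (q : Fin n → N),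
    ∑ i, m i ⊗ₜ[R] q i = 0 → liftedTensor (K m) m q = 0

lemma exists_directLimit_lift {ι : Type u} [Preorder ι] [IsDirected ι (· ≤ ·)] [Nonempty ι]
    [DecidableEq ι] {G : ι → Type u} [∀ i, AddCommGroup (G i)] [∀ i, Module R (G i)]
    (f : ∀ i j, i ≤ j → G i →ₗ[R] G j) {n : ℕ} (q : Fin n → Module.DirectLimit G f) :
    ∃ (k : ι) (p : Fin n → G k), q = fun i => Module.DirectLimit.of R ι G f k (p i) := by
  choose k p hp using fun i => Module.DirectLimit.exists_of (q i)
  obtain ⟨l, hl⟩ := Finite.exists_le k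
  exact ⟨l, fun i => f _ _ (hl i) (p i), by ext i; simp [hp]⟩

lemma isDefinableClass_uniformRelations
    {K : ∀ {n : ℕ}, (Fin n → M) → Submodule R (M →₀ R)}
    (hfg : ∀ {n : ℕ} (m : Fin n → M), (K m).FG) :
    IsDefinableClass R (UniformRelations K) where
  closed_iso N₁ _ _ N₂ _ _ := by
    rintro ⟨e⟩ h n m q hq
    have h₁ := h n m (fun i => e.symm (q i))
      (by simpa using congrArg (e.symm.toLinearMap.lTensor M) hq)
    simpa [lTensor_liftedTensor] using congrArg (e.toLinearMap.lTensor _) h₁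
  closed_prod I N _ _ h n m q hq := by
    apply piRightHom_finsupp_quotient_injective (hfg m) N
    ext i
    rw [piRightHom_liftedTensor, h i n m]
    · simp
    · simpa [Finset.sum_apply] using congrFun (congrArg (TensorProduct.piRightHom R R M N) hq) i
  closed_directLimit ι _ _ _ G _ _ f _ h n m q hq := by
    rcases isEmpty_or_nonempty ι with hι | hι
    · simp [liftedTensor, Subsingleton.elim q 0]
    obtain ⟨k, p, rfl⟩ := exists_directLimit_lift f q
    have h0 := congrArg (TensorProduct.directLimitRight f M) hq
    simp only [map_sum, TensorProduct.directLimitRight_tmul_of, map_zero] at h0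
    rw [← map_sum] at h0
    obtain ⟨l, hkl, hl⟩ := Module.DirectLimit.of.zero_exact h0
    have h₁ := h l n m (fun i => f k l hkl (p i)) (by simpa using hl)
    simpa [lTensor_liftedTensor] using
      congrArg ((Module.DirectLimit.of R ι G f l).lTensor _) h₁
  closed_pureSubmodule N _ _ p hp h n m q hq := by
    have h₁ := h n m (fun i => (q i : N)) (by simpa using congrArg (p.subtype.lTensor M) hq)
    have hinj : Function.Injective (p.subtype.lTensor ((M →₀ R) ⧸ K m)) :=
      (LinearMap.lTensor_inj_iff_rTensor_inj _ _).2 (hp _)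
    apply hinj
    simpa [lTensor_liftedTensor] using h₁

lemma isRelMittagLeffler_uniformRelations
    {K : ∀ {n : ℕ}, (Fin n → M) → Submodule R (M →₀ R)}
    (hfg : ∀ {n : ℕ} (m : Fin n → M), (K m).FG)
    (hle : ∀ {n : ℕ} (m : Fin n → M),
      K m ≤ LinearMap.ker (Finsupp.linearCombination R (id : M → M))) :
    IsRelMittagLeffler R M (UniformRelations K) := by
  intro I N _ _ hN
  rw [injective_iff_map_eq_zero]
  intro t ht
  obtain ⟨n, m, q, rfl⟩ := TensorProduct.exists_sum_tmul_eq t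
  apply sum_tmul_eq_zero_of_liftedTensor_eq_zero (hle m)
  apply piRightHom_finsupp_quotient_injective (hfg m) N
  ext i
  rw [piRightHom_liftedTensor, hN i n m]
  · simp
  · simpa [Finset.sum_apply] using congrFun ht i

end MittagLeffler

/-- If `M` is `𝒬`-Mittag-Leffler, then `M` is `Def(𝒬)`-Mittag-Leffler, where
`Def(𝒬)` is the definable closure of `𝒬`. -/
theorem stmt_5 (R : Type u) [CommRing R]
    (𝒬 : (N : Type u) → [AddCommGroup N] → [Module R N] → Prop)
    (M : Type u) [AddCommGroup M] [Module R M]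
    (hml : IsRelMittagLeffler R M 𝒬) :
    IsRelMittagLeffler R M (DefClosure R 𝒬) := by
  choose K hfg hle hK using fun (n : ℕ) (m : Fin n → M) => hml.exists_uniform_relations m
  intro I N _ _ hN
  refine isRelMittagLeffler_uniformRelations (K := fun {n} => K n) (hfg _) (hle _) I N
    fun i => hN i _ (isDefinableClass_uniformRelations (hfg _)) ?_
  exact fun Q _ _ hQ n m q => hK n m Q hQ q

end
end

section
/- Let φ : R → S be a faithfully flat homomorphism of commutative rings, Q a definable class of R-modules, and B = Q^∨ its dual definable class. Let Q' be the least definable class of S-modules containing Q ⊗_R S and B' the dual definable class of Q'. If M is a countably presented flat R-module, then Ext_R^1(M, B) = 0 for all B ∈ B if and only if Ext_S^1(M ⊗_R S, B') = 0 for all B' ∈ B'. -/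
open TensorProduct CategoryTheory

universe u

noncomputable section

/-- `Ext¹` computed by a projective resolution, elementwise: every `1`-cocycle is a coboundary. -/
lemma ext1Vanishes_iff_resolution {A : Type u} [CommRing A] {M B : Type u} [AddCommGroup M]
    [Module A M] [AddCommGroup B] [Module A B] (P : ProjectiveResolution (ModuleCat.of A M)) :
    Ext1Vanishes A M B ↔ ∀ φ : P.complex.X 1 →ₗ[A] B, φ ∘ₗ (P.complex.d 2 1).hom = 0 →
      ∃ k : P.complex.X 0 →ₗ[A] B, φ = k ∘ₗ (P.complex.d 1 0).hom := by
  have h1 : Ext1Vanishes A M B ↔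
      (P.complex.linearYonedaObj A (ModuleCat.of A B)).ExactAt 1 := by
    rw [HomologicalComplex.exactAt_iff_isZero_homology,
      ← (P.isoExt (R := A) 1 (ModuleCat.of A B)).isZero_iff, ModuleCat.isZero_iff_subsingleton]
    rfl
  rw [h1, HomologicalComplex.exactAt_iff' _ 0 1 2 (by simp) (by simp),
    ShortComplex.moduleCat_exact_iff]
  constructor
  · intro h φ hφ
    obtain ⟨k, hk⟩ := h (ModuleCat.ofHom φ) (by
      change P.complex.d 2 1 ≫ ModuleCat.ofHom φ = 0
      ext x
      exact LinearMap.congr_fun hφ x)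
    refine ⟨ModuleCat.Hom.hom k, ?_⟩
    have hk' : P.complex.d 1 0 ≫ k = ModuleCat.ofHom φ := hk
    exact (congrArg ModuleCat.Hom.hom hk').symm
  · intro h φ hφ
    have hφ' : P.complex.d 2 1 ≫ φ = 0 := hφ
    obtain ⟨k, hk⟩ := h (ModuleCat.Hom.hom φ) (congrArg ModuleCat.Hom.hom hφ')
    refine ⟨ModuleCat.ofHom k, ?_⟩
    change P.complex.d 1 0 ≫ ModuleCat.ofHom k = φ
    ext x
    exact (LinearMap.congr_fun hk x).symm

/-- A linear map out of a projective module lifts along an exact pair. -/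
lemma LinearMap.exists_lift_of_exact {A : Type u} [CommRing A] {P X Y Z : Type u} [AddCommGroup P]
    [Module A P] [AddCommGroup X] [Module A X] [AddCommGroup Y] [Module A Y] [AddCommGroup Z]
    [Module A Z] [Module.Projective A P] {f : X →ₗ[A] Y} {g : Y →ₗ[A] Z}
    (hfg : Function.Exact f g) (h : P →ₗ[A] Y) (hh : g ∘ₗ h = 0) :
    ∃ k : P →ₗ[A] X, f ∘ₗ k = h := by
  have hr : ∀ x, h x ∈ LinearMap.range f := fun x => (hfg _).1 (LinearMap.congr_fun hh x)
  obtain ⟨k, hk⟩ := Module.projective_lifting_property f.rangeRestrict (h.codRestrict _ hr)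
    f.surjective_rangeRestrict
  refine ⟨k, LinearMap.ext fun x => ?_⟩
  exact congrArg Subtype.val (LinearMap.congr_fun hk x)

/-- `Ext¹` computed by a projective presentation of length one. -/
lemma ext1Vanishes_iff_of_shortExact {A : Type u} [CommRing A] {M B X₀ X₁ : Type u}
    [AddCommGroup M] [Module A M] [AddCommGroup B] [Module A B] [AddCommGroup X₀] [Module A X₀]
    [AddCommGroup X₁] [Module A X₁] [Module.Projective A X₀] [Module.Projective A X₁]
    (Ψ : X₁ →ₗ[A] X₀) (p : X₀ →ₗ[A] M) (hΨ : Function.Injective Ψ) (hex : Function.Exact Ψ p)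
    (hp : Function.Surjective p) :
    Ext1Vanishes A M B ↔ ∀ h : X₁ →ₗ[A] B, ∃ k : X₀ →ₗ[A] B, h = k ∘ₗ Ψ := by
  let P := projectiveResolution (ModuleCat.of A M)
  rw [ext1Vanishes_iff_resolution P]
  have proj (n : ℕ) : Module.Projective A (P.complex.X n) :=
    (IsProjective.iff_projective _).2 (P.projective n)
  let d₁ := (P.complex.d 1 0).hom
  let d₂ := (P.complex.d 2 1).hom
  let ε : P.complex.X 0 →ₗ[A] M := (P.π.f 0).hom
  have hε : Function.Surjective ε := (ModuleCat.epi_iff_surjective (P.π.f 0)).1 inferInstance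
  have hex₁ : Function.Exact d₁ ε := by
    have := P.exact₀
    exact (ShortComplex.ShortExact.moduleCat_exact_iff_function_exact _).1 this
  have hex₂ : Function.Exact d₂ d₁ :=
    (ShortComplex.ShortExact.moduleCat_exact_iff_function_exact _).1 (P.exact_succ 0)
  have hΨp : p ∘ₗ Ψ = 0 := hex.linearMap_comp_eq_zero
  have hdε : ε ∘ₗ d₁ = 0 := hex₁.linearMap_comp_eq_zero
  have hdd : d₁ ∘ₗ d₂ = 0 := hex₂.linearMap_comp_eq_zero
  obtain ⟨a₀, ha₀⟩ := Module.projective_lifting_property p ε hp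
  obtain ⟨a₁, ha₁⟩ := LinearMap.exists_lift_of_exact hex (a₀ ∘ₗ d₁)
    (by rw [← LinearMap.comp_assoc, ha₀, hdε])
  obtain ⟨b₀, hb₀⟩ := Module.projective_lifting_property ε p hε
  obtain ⟨b₁, hb₁⟩ := LinearMap.exists_lift_of_exact hex₁ (b₀ ∘ₗ Ψ)
    (by rw [← LinearMap.comp_assoc, hb₀, hΨp])
  have ha₁' (x) : Ψ (a₁ x) = a₀ (d₁ x) := LinearMap.congr_fun ha₁ x
  have hb₁' (x) : d₁ (b₁ x) = b₀ (Ψ x) := LinearMap.congr_fun hb₁ x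
  have ha₀' (x) : p (a₀ x) = ε x := LinearMap.congr_fun ha₀ x
  have hb₀' (x) : ε (b₀ x) = p x := LinearMap.congr_fun hb₀ x
  constructor
  · intro H h
    obtain ⟨k, hk⟩ := H (h ∘ₗ a₁) (by
      refine LinearMap.ext fun x => ?_
      have : a₁ (d₂ x) = 0 := hΨ (by
        rw [ha₁', map_zero, show d₁ (d₂ x) = 0 from LinearMap.congr_fun hdd x, map_zero])
      change h (a₁ (d₂ x)) = 0
      rw [this, map_zero])
    obtain ⟨c, hc⟩ := LinearMap.exists_lift_of_exact hex (a₀ ∘ₗ b₀ - LinearMap.id) (by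
      ext x; simp [ha₀', hb₀'])
    refine ⟨k ∘ₗ b₀ - h ∘ₗ c, LinearMap.ext fun x => ?_⟩
    have hc' (y) : Ψ (c y) = a₀ (b₀ y) - y := LinearMap.congr_fun hc y
    have hk' (y) : h (a₁ y) = k (d₁ y) := LinearMap.congr_fun hk y
    have : a₁ (b₁ x) - x = c (Ψ x) := hΨ (by
      rw [map_sub, ha₁', hb₁', hc'])
    simp only [LinearMap.comp_apply, LinearMap.sub_apply]
    rw [← this, map_sub, hk', hb₁']
    abel
  · intro H φ hφ
    obtain ⟨k, hk⟩ := H (φ ∘ₗ b₁)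
    obtain ⟨c, hc⟩ := LinearMap.exists_lift_of_exact hex₁ (b₀ ∘ₗ a₀ - LinearMap.id) (by
      ext x; simp [ha₀', hb₀'])
    have hc' (y) : d₁ (c y) = b₀ (a₀ y) - y := LinearMap.congr_fun hc y
    obtain ⟨e, he⟩ := LinearMap.exists_lift_of_exact hex₂ (b₁ ∘ₗ a₁ - LinearMap.id - c ∘ₗ d₁) (by
      ext x; simp [hb₁', ha₁', hc'])
    refine ⟨k ∘ₗ a₀ - φ ∘ₗ c, LinearMap.ext fun x => ?_⟩
    have hk' (y) : φ (b₁ y) = k (Ψ y) := LinearMap.congr_fun hk y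
    have he' : d₂ (e x) = b₁ (a₁ x) - x - c (d₁ x) := LinearMap.congr_fun he x
    have h0 : φ (d₂ (e x)) = 0 := LinearMap.congr_fun hφ (e x)
    rw [he', map_sub, map_sub, hk', ha₁'] at h0
    change φ x = k (a₀ (d₁ x)) - φ (c (d₁ x))
    rw [← sub_eq_zero, ← neg_eq_zero, ← h0]
    abel

/-- A module `M` written as the union of a telescope of finite free modules `F i`, with
transition maps `t i j` (meaningful for `i < j`) and structure maps `g i`. -/
structure FreeTelescope (A : Type u) [CommRing A] (M : Type u) [AddCommGroup M] [Module A M]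
    (F : ℕ → Type u) [∀ i, AddCommGroup (F i)] [∀ i, Module A (F i)] where
  free : ∀ i, Module.Free A (F i)
  finite : ∀ i, Module.Finite A (F i)
  t : ∀ i j, F i →ₗ[A] F j
  g : ∀ i, F i →ₗ[A] M
  t_comp : ∀ {i j k}, i < j → j < k → t j k ∘ₗ t i j = t i k
  g_comp : ∀ {i j}, i < j → g j ∘ₗ t i j = g i
  exists_rep : ∀ x, ∃ i y, g i y = x
  exists_t_eq_zero : ∀ i x, g i x = 0 → ∃ j, i < j ∧ t i j x = 0

namespace FreeTelescope

variable {A : Type u} [CommRing A] {M : Type u} [AddCommGroup M] [Module A M]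
    {F : ℕ → Type u} [∀ i, AddCommGroup (F i)] [∀ i, Module A (F i)]

lemma t_t (T : FreeTelescope A M F) {i j k : ℕ} (hij : i < j) (hjk : j < k) (x : F i) :
    T.t j k (T.t i j x) = T.t i k x :=
  LinearMap.congr_fun (T.t_comp hij hjk) x

lemma g_t (T : FreeTelescope A M F) {i j : ℕ} (hij : i < j) (x : F i) :
    T.g j (T.t i j x) = T.g i x :=
  LinearMap.congr_fun (T.g_comp hij) x

/-- Passing to a cofinal subsequence. -/
def reindex (T : FreeTelescope A M F) (σ : ℕ → ℕ) (hσ : StrictMono σ) :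
    FreeTelescope A M (fun i => F (σ i)) where
  free i := T.free _
  finite i := T.finite _
  t i j := T.t (σ i) (σ j)
  g i := T.g (σ i)
  t_comp hij hjk := T.t_comp (hσ hij) (hσ hjk)
  g_comp hij := T.g_comp (hσ hij)
  exists_rep x := by
    obtain ⟨i, y, rfl⟩ := T.exists_rep x
    have : i < σ (i + 1) := (Nat.lt_succ_self i).trans_le (hσ.id_le _)
    exact ⟨i + 1, T.t i _ y, T.g_t this y⟩
  exists_t_eq_zero i x hx := by
    obtain ⟨j, hij, hj⟩ := T.exists_t_eq_zero _ x hx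
    have h : j < σ (j + 1) := (Nat.lt_succ_self j).trans_le (hσ.id_le _)
    refine ⟨j + 1, hσ.lt_iff_lt.1 (hij.trans h), ?_⟩
    rw [← T.t_t hij h, hj, map_zero]

/-- The map `⨁ F i → ⨁ F i` sending `x` in degree `i` to `x - t i (i + 1) x`. -/
def shift (T : FreeTelescope A M F) : (DirectSum ℕ F) →ₗ[A] DirectSum ℕ F :=
  DirectSum.toModule A ℕ _ fun i =>
    DirectSum.lof A ℕ F i - DirectSum.lof A ℕ F (i + 1) ∘ₗ T.t i (i + 1)

/-- The canonical map `⨁ F i → M`. -/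
def total (T : FreeTelescope A M F) : (DirectSum ℕ F) →ₗ[A] M :=
  DirectSum.toModule A ℕ _ T.g

lemma shift_lof (T : FreeTelescope A M F) (i : ℕ) (x : F i) :
    T.shift (DirectSum.lof A ℕ F i x) =
      DirectSum.lof A ℕ F i x - DirectSum.lof A ℕ F (i + 1) (T.t i (i + 1) x) := by
  simp [shift, DirectSum.toModule_lof]

lemma total_lof (T : FreeTelescope A M F) (i : ℕ) (x : F i) :
    T.total (DirectSum.lof A ℕ F i x) = T.g i x := by
  simp [total, DirectSum.toModule_lof]

lemma total_surjective (T : FreeTelescope A M F) : Function.Surjective T.total := fun x => by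
  obtain ⟨i, y, rfl⟩ := T.exists_rep x
  exact ⟨_, T.total_lof i y⟩

lemma shift_apply_zero (T : FreeTelescope A M F) (x : DirectSum ℕ F) : T.shift x 0 = x 0 := by
  induction x using DirectSum.induction_on with
  | zero => simp
  | of i x =>
    change T.shift (DirectSum.lof A ℕ F i x) 0 = _
    rw [shift_lof, DirectSum.sub_apply, DirectSum.lof_eq_of, DirectSum.lof_eq_of,
      DirectSum.of_eq_of_ne (i + 1) 0 _ (by simp), sub_zero]
  | add x y hx hy => simp [hx, hy]

lemma shift_apply_succ (T : FreeTelescope A M F) (x : DirectSum ℕ F) (j : ℕ) :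
    T.shift x (j + 1) = x (j + 1) - T.t j (j + 1) (x j) := by
  induction x using DirectSum.induction_on with
  | zero => simp
  | of i x =>
    change T.shift (DirectSum.lof A ℕ F i x) _ = _
    rw [shift_lof, DirectSum.sub_apply, DirectSum.lof_eq_of, DirectSum.lof_eq_of]
    congr 1
    obtain rfl | h := eq_or_ne i j
    · simp [DirectSum.of_eq_same]
    · rw [DirectSum.of_eq_of_ne _ _ _ h.symm, DirectSum.of_eq_of_ne _ _ _ (by omega), map_zero]
  | add x y hx hy => simp only [map_add, DirectSum.add_apply, hx, hy]; abel

lemma shift_injective (T : FreeTelescope A M F) : Function.Injective T.shift := by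
  rw [injective_iff_map_eq_zero]
  intro x hx
  ext j
  induction j with
  | zero => rw [← T.shift_apply_zero, hx]
  | succ j ih =>
    have := T.shift_apply_succ x j
    rw [hx, ih] at this
    simpa using this.symm

lemma lof_sub_lof_t_mem (T : FreeTelescope A M F) {i j : ℕ} (hij : i < j) (x : F i) :
    DirectSum.lof A ℕ F i x - DirectSum.lof A ℕ F j (T.t i j x) ∈ LinearMap.range T.shift := by
  induction j, hij using Nat.le_induction with
  | base => exact ⟨_, T.shift_lof i x⟩
  | succ j hij ih =>
    have h : DirectSum.lof A ℕ F j (T.t i j x) - DirectSum.lof A ℕ F (j + 1) (T.t i (j + 1) x) ∈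
        LinearMap.range T.shift :=
      ⟨_, by rw [T.shift_lof j (T.t i j x), T.t_t hij (Nat.lt_succ_self j)]⟩
    simpa using add_mem ih h

lemma exists_sub_lof_mem (T : FreeTelescope A M F) (x : DirectSum ℕ F) :
    ∃ i y, x - DirectSum.lof A ℕ F i y ∈ LinearMap.range T.shift := by
  induction x using DirectSum.induction_on with
  | zero => exact ⟨0, 0, by simp⟩
  | of i x => exact ⟨i, x, by simp [DirectSum.lof_eq_of]⟩
  | add x y hx hy =>
    obtain ⟨i, x', hx⟩ := hx
    obtain ⟨j, y', hy⟩ := hy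
    have hi : i < i + j + 1 := by omega
    have hj : j < i + j + 1 := by omega
    refine ⟨i + j + 1, T.t i _ x' + T.t j _ y', ?_⟩
    convert add_mem (add_mem hx (T.lof_sub_lof_t_mem hi x'))
      (add_mem hy (T.lof_sub_lof_t_mem hj y')) using 1
    rw [map_add]
    abel

lemma shift_total_exact (T : FreeTelescope A M F) : Function.Exact T.shift T.total := by
  have hle : T.total ∘ₗ T.shift = 0 := by
    ext i x
    simp only [LinearMap.comp_apply, shift_lof, map_sub, total_lof, T.g_t (Nat.lt_succ_self i),
      sub_self, LinearMap.zero_apply]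
  intro x
  refine ⟨fun hx => ?_, ?_⟩
  · obtain ⟨i, y, h⟩ := T.exists_sub_lof_mem x
    have hy : T.g i y = 0 := by
      obtain ⟨z, hz⟩ := h
      have := LinearMap.congr_fun hle z
      rw [LinearMap.comp_apply, hz, map_sub, hx, total_lof] at this
      simpa using this
    obtain ⟨j, hij, hj⟩ := T.exists_t_eq_zero i y hy
    have h' := T.lof_sub_lof_t_mem hij y
    rw [hj, map_zero, sub_zero] at h'
    simpa using add_mem h h'
  · rintro ⟨y, rfl⟩
    exact LinearMap.congr_fun hle y

/-- `Ext¹(M, B)` is `lim¹` of the tower `Hom(F i, B)`. -/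
lemma ext1Vanishes_iff (T : FreeTelescope A M F) {B : Type u} [AddCommGroup B] [Module A B] :
    Ext1Vanishes A M B ↔ ∀ y : ∀ i, F i →ₗ[A] B, ∃ x : ∀ i, F i →ₗ[A] B,
      ∀ i, y i = x i - x (i + 1) ∘ₗ T.t i (i + 1) := by
  have := T.free
  rw [ext1Vanishes_iff_of_shortExact T.shift T.total T.shift_injective T.shift_total_exact
    T.total_surjective]
  constructor
  · intro H y
    obtain ⟨k, hk⟩ := H (DirectSum.toModule A ℕ _ y)
    refine ⟨fun i => k ∘ₗ DirectSum.lof A ℕ F i, fun i => LinearMap.ext fun x => ?_⟩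
    have := LinearMap.congr_fun hk (DirectSum.lof A ℕ F i x)
    rw [DirectSum.toModule_lof, LinearMap.comp_apply, shift_lof, map_sub] at this
    exact this
  · intro H h
    obtain ⟨x, hx⟩ := H fun i => h ∘ₗ DirectSum.lof A ℕ F i
    refine ⟨DirectSum.toModule A ℕ _ x, ?_⟩
    ext i y
    have := LinearMap.congr_fun (hx i) y
    simp only [LinearMap.comp_apply] at this
    simp only [LinearMap.comp_apply, shift_lof, map_sub, DirectSum.toModule_lof, this,
      LinearMap.sub_apply]

end FreeTelescope

/-- Every map `F → B` factoring through `α` also factors through `β`. -/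
def FactorsThrough {A : Type u} [CommRing A] {F G H : Type u} [AddCommGroup F] [Module A F]
    [AddCommGroup G] [Module A G] [AddCommGroup H] [Module A H]
    (α : F →ₗ[A] G) (β : F →ₗ[A] H) (B : Type u) [AddCommGroup B] [Module A B] : Prop :=
  ∀ h : G →ₗ[A] B, ∃ h' : H →ₗ[A] B, h ∘ₗ α = h' ∘ₗ β

/-- `ker (β ⊗ Q) ⊆ ker (α ⊗ Q)`. -/
def KerLE {A : Type u} [CommRing A] {F G H : Type u} [AddCommGroup F] [Module A F]
    [AddCommGroup G] [Module A G] [AddCommGroup H] [Module A H]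
    (α : F →ₗ[A] G) (β : F →ₗ[A] H) (Q : Type u) [AddCommGroup Q] [Module A Q] : Prop :=
  ∀ z : F ⊗[A] Q, β.rTensor Q z = 0 → α.rTensor Q z = 0

namespace FreeTelescope

variable {A : Type u} [CommRing A] {M : Type u} [AddCommGroup M] [Module A M]
    {F : ℕ → Type u} [∀ i, AddCommGroup (F i)] [∀ i, Module A (F i)]

/-- If the tower `Hom(F i, B)` has stable images after one step, then `Ext¹(M, B) = 0`. -/
lemma ext1Vanishes_of_factorsThrough (T : FreeTelescope A M F) {B : Type u} [AddCommGroup B]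
    [Module A B] (H : ∀ i, FactorsThrough (T.t i (i + 1)) (T.t i (i + 2)) B) :
    Ext1Vanishes A M B := by
  rw [T.ext1Vanishes_iff]
  intro y
  choose φ hφ using H
  let w : ∀ i, F (i + 1) →ₗ[A] B := fun i =>
    Nat.rec (motive := fun i => F (i + 1) →ₗ[A] B) 0 (fun i w => φ i (w - y (i + 1))) i
  have hw (i) : (w i - y (i + 1)) ∘ₗ T.t i (i + 1) = w (i + 1) ∘ₗ T.t i (i + 2) := hφ i _
  refine ⟨fun i => w i ∘ₗ T.t i (i + 1) + y i, fun i => LinearMap.ext fun x => ?_⟩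
  have h := LinearMap.congr_fun (hw i) x
  simp only [LinearMap.comp_apply, LinearMap.sub_apply, LinearMap.add_apply] at h ⊢
  rw [T.t_t (Nat.lt_succ_self i) (Nat.lt_succ_self _), ← h]
  abel

/-- If `Ext¹(M, ⨁ B i) = 0`, then the images in the towers `Hom(F i, B j)` stabilise somewhere. -/
lemma exists_factorsThrough (T : FreeTelescope A M F) (B : ℕ → Type u)
    [∀ i, AddCommGroup (B i)] [∀ i, Module A (B i)]
    (H : Ext1Vanishes A M (DirectSum ℕ B)) :
    ∃ j, 0 < j ∧ FactorsThrough (T.t 0 j) (T.t 0 (j + 1)) (B j) := by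
  by_contra! hcon
  have hcon' (j) : ∃ h : F j →ₗ[A] B j, 0 < j →
      ∀ h' : F (j + 1) →ₗ[A] B j, h ∘ₗ T.t 0 j ≠ h' ∘ₗ T.t 0 (j + 1) := by
    by_cases hj : 0 < j
    · have := hcon j hj
      unfold FactorsThrough at this
      push Not at this
      exact this.imp fun _ h _ => h
    · exact ⟨0, fun h => absurd h hj⟩
  choose h hh using hcon'
  obtain ⟨x, hx⟩ := T.ext1Vanishes_iff.1 H fun i => DirectSum.lof A ℕ B i ∘ₗ h i
  have hx' (i j : ℕ) (z : F i) : DirectSum.of B i (h i z) j =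
      x i z j - x (i + 1) (T.t i (i + 1) z) j :=
    congrArg (fun w : DirectSum ℕ B => w j) (LinearMap.congr_fun (hx i) z)
  have key (j i : ℕ) (hi : i < j) (z : F 0) : x 0 z j = x (i + 1) (T.t 0 (i + 1) z) j := by
    induction i with
    | zero =>
      rw [← sub_eq_zero, ← hx' 0 j z, DirectSum.of_eq_of_ne _ _ _ (by omega)]
    | succ i ih =>
      rw [ih (by omega), ← T.t_t (Nat.succ_pos i) (Nat.lt_succ_self _), ← sub_eq_zero,
        ← hx' (i + 1) j, DirectSum.of_eq_of_ne _ _ _ (by omega)]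
  have := T.finite 0
  obtain ⟨s, hs⟩ := (Module.finite_def (R := A) (M := F 0)).1 inferInstance
  obtain ⟨j, hj0, hj⟩ : ∃ j, 0 < j ∧ ∀ z ∈ s, x 0 z j = 0 := by
    classical
    obtain ⟨j, hj⟩ := (insert 0 (s.biUnion fun z => DFinsupp.support (x 0 z))).exists_notMem
    simp only [Finset.mem_insert, Finset.mem_biUnion, not_or, not_exists, not_and,
      DFinsupp.mem_support_toFun, not_not] at hj
    exact ⟨j, Nat.pos_of_ne_zero hj.1, hj.2⟩
  have hzero : DirectSum.component A ℕ B j ∘ₗ x 0 = 0 :=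
    LinearMap.ext_on hs fun z hz => hj z hz
  refine hh j hj0 (-(DirectSum.component A ℕ B j ∘ₗ x (j + 1))) (LinearMap.ext fun z => ?_)
  obtain ⟨i, rfl⟩ : ∃ i, j = i + 1 := ⟨j - 1, by omega⟩
  have h0 : x (i + 1) (T.t 0 (i + 1) z) (i + 1) = 0 := by
    rw [← key (i + 1) i (Nat.lt_succ_self i)]
    exact LinearMap.congr_fun hzero z
  have h1 := hx' (i + 1) (i + 1) (T.t 0 (i + 1) z)
  rw [DirectSum.of_eq_same, h0, T.t_t hj0 (Nat.lt_succ_self _), zero_sub] at h1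
  exact h1

end FreeTelescope

section Lazard

variable {A : Type u} [CommRing A] {M : Type u} [AddCommGroup M] [Module A M]

/-- A finite piece of a countable presentation `p : (ℕ →₀ A) → M` of a flat module factors
through a finite free module. -/
lemma exists_finite_free_factorization [Module.Flat A M] (p : (ℕ →₀ A) →ₗ[A] M)
    (hp : Function.Surjective p) (n : ℕ) (s : Finset (ℕ →₀ A)) (hs : ∀ x ∈ s, p x = 0) :
    ∃ (k : ℕ) (u : (ℕ →₀ A) →ₗ[A] (Fin k →₀ A)) (v : (Fin k →₀ A) →ₗ[A] (ℕ →₀ A)),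
      (∀ i < n, p (v (u (Finsupp.single i 1))) = p (Finsupp.single i 1)) ∧
      ∀ x ∈ s, u x = 0 := by
  classical
  obtain ⟨N, hnN, hN⟩ : ∃ N, n ≤ N ∧ ∀ x ∈ s, ∀ i ∈ x.support, i < N := by
    refine ⟨n + (s.biUnion Finsupp.support).sup id + 1, by omega, fun x hx i hi => ?_⟩
    have : i ≤ (s.biUnion Finsupp.support).sup id :=
      Finset.le_sup (f := id) (Finset.mem_biUnion.2 ⟨x, hx, hi⟩)
    omega
  let ι : (Fin N →₀ A) →ₗ[A] (ℕ →₀ A) := Finsupp.lmapDomain A A Fin.val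
  let ρ : (ℕ →₀ A) →ₗ[A] (Fin N →₀ A) :=
    Finsupp.lcomapDomain Fin.val Fin.val_injective
  have hιρ (x : ℕ →₀ A) (hx : ∀ i ∈ x.support, i < N) : ι (ρ x) = x := by
    refine Finsupp.mapDomain_comapDomain _ Fin.val_injective _ fun i hi => ?_
    exact ⟨⟨i, hx i hi⟩, rfl⟩
  let f : (s →₀ A) →ₗ[A] (Fin N →₀ A) := Finsupp.linearCombination A fun x : s => ρ x
  obtain ⟨k, a, y, hya, haf⟩ := Module.Flat.exists_factorization_of_comp_eq_zero_of_free
    (f := f) (x := p ∘ₗ ι) (by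
      ext x
      simp only [f, LinearMap.comp_apply, Finsupp.lsingle_apply,
        Finsupp.linearCombination_single, one_smul, LinearMap.zero_apply]
      rw [hιρ _ (hN x x.2), hs x x.2])
  obtain ⟨v, hv⟩ := Module.projective_lifting_property p y hp
  refine ⟨k, a ∘ₗ ρ, v, fun i hi => ?_, fun x hx => ?_⟩
  · have h1 := LinearMap.congr_fun hv (a (ρ (Finsupp.single i 1)))
    have h2 := LinearMap.congr_fun hya (ρ (Finsupp.single i 1))
    simp only [LinearMap.comp_apply] at h1 h2 ⊢
    rw [h1, ← h2, hιρ]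
    intro j hj
    rw [Finset.mem_singleton.1 (Finsupp.support_single_subset hj)]
    omega
  · have := LinearMap.congr_fun haf (Finsupp.single ⟨x, hx⟩ 1)
    simpa [f] using this

/-- The data at one stage of the construction of a telescope for a flat module. -/
structure LazardStage (p : (ℕ →₀ A) →ₗ[A] M) where
  n : ℕ
  k : ℕ
  u : (ℕ →₀ A) →ₗ[A] (Fin k →₀ A)
  v : (Fin k →₀ A) →ₗ[A] (ℕ →₀ A)
  p_v_u : ∀ i < n, p (v (u (Finsupp.single i 1))) = p (Finsupp.single i 1)

namespace LazardStage

/-- The compatibility of consecutive stages: `Y` knows the image of `X.v`, kills the defects of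
`X`, and kills the `i`-th element of the list `r` of relations. -/
structure Rel {p : (ℕ →₀ A) →ₗ[A] M} (r : ℕ → ℕ →₀ A) (i : ℕ) (X Y : LazardStage p) : Prop where
  n_lt : X.n < Y.n
  support_lt : ∀ x, ∀ j ∈ (X.v x).support, j < Y.n
  u_v_u : ∀ j < X.n, Y.u (X.v (X.u (Finsupp.single j 1))) = Y.u (Finsupp.single j 1)
  u_r : ∀ j ≤ i, Y.u (r j) = 0

lemma exists_rel [Module.Flat A M] {p : (ℕ →₀ A) →ₗ[A] M} (hp : Function.Surjective p)
    (r : ℕ → ℕ →₀ A) (hr : ∀ j, p (r j) = 0) (i : ℕ) (X : LazardStage p) :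
    ∃ Y, Rel r i X Y := by
  classical
  let B : Finset ℕ := Finset.univ.biUnion fun l : Fin X.k => (X.v (Finsupp.single l 1)).support
  let n := X.n + 1 + B.sup id + 1
  let s : Finset (ℕ →₀ A) :=
    (Finset.range X.n).image (fun j => X.v (X.u (Finsupp.single j 1)) - Finsupp.single j 1) ∪
      (Finset.range (i + 1)).image r
  obtain ⟨k, u, v, hpvu, hu⟩ := exists_finite_free_factorization p hp n s (by
    intro x hx
    simp only [s, Finset.mem_union, Finset.mem_image, Finset.mem_range] at hx
    obtain ⟨j, hj, rfl⟩ | ⟨j, -, rfl⟩ := hx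
    · rw [map_sub, X.p_v_u j hj, sub_self]
    · exact hr j)
  refine ⟨⟨n, k, u, v, hpvu⟩, ⟨by change X.n < n; omega, ?_, ?_, ?_⟩⟩
  · intro x
    suffices X.v x ∈ Finsupp.supported A A (Set.Iio n) from fun j hj => this hj
    induction x using Finsupp.induction_linear with
    | zero => simp
    | add x y hx hy => rw [map_add]; exact add_mem hx hy
    | single l a =>
      rw [← mul_one a, ← smul_eq_mul, ← Finsupp.smul_single, map_smul]
      refine Submodule.smul_mem _ _ fun j hj => ?_
      have : j ≤ B.sup id :=
        Finset.le_sup (f := id) (Finset.mem_biUnion.2 ⟨l, Finset.mem_univ l, hj⟩)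
      change j < n
      omega
  · intro j hj
    rw [← sub_eq_zero, ← map_sub]
    refine hu _ (Finset.mem_union_left _ (Finset.mem_image.2 ⟨j, by simpa using hj, rfl⟩))
  · intro j hj
    exact hu _ (Finset.mem_union_right _ (Finset.mem_image.2 ⟨j, by simp; omega, rfl⟩))

end LazardStage

/-- A countably presented flat module is a sequential colimit of finite free modules. -/
lemma exists_freeTelescope (hcp : CountablyPresented A M) [Module.Flat A M] :
    ∃ (k : ℕ → ℕ), Nonempty (FreeTelescope A M fun i => Fin (k i) →₀ A) := by
  obtain ⟨p, hp, s, hsc, hs⟩ := hcp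
  obtain ⟨r, hr⟩ : ∃ r : ℕ → ℕ →₀ A, insert 0 s = Set.range r :=
    (hsc.insert 0).exists_eq_range (Set.insert_nonempty _ _)
  have hr' : Submodule.span A (Set.range r) = LinearMap.ker p := by
    rw [← hr, Submodule.span_insert_zero, hs]
  have hpr (j) : p (r j) = 0 := by
    have : r j ∈ LinearMap.ker p := hr' ▸ Submodule.subset_span ⟨j, rfl⟩
    exact this
  choose next hnext using fun i (X : LazardStage p) => LazardStage.exists_rel hp r hpr i X
  let X : ℕ → LazardStage p := fun i => Nat.rec (⟨0, 0, 0, 0, by simp⟩) next i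
  have hX (i) : LazardStage.Rel r i (X i) (X (i + 1)) := hnext i (X i)
  have hn : StrictMono fun i => (X i).n := strictMono_nat_of_lt_succ fun i => (hX i).n_lt
  have ext_of_support {N : Type u} [AddCommGroup N] [Module A N] (f g : (ℕ →₀ A) →ₗ[A] N) (n : ℕ)
      (hfg : ∀ j < n, f (Finsupp.single j 1) = g (Finsupp.single j 1)) (x : ℕ →₀ A)
      (hx : ∀ j ∈ x.support, j < n) : f x = g x := by
    have hx' : x ∈ Submodule.span A ((fun i => Finsupp.single i (1 : A)) '' Set.Iio n) := by
      rw [← Finsupp.supported_eq_span_single]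
      exact hx
    refine LinearMap.eqOn_span (f := f) (g := g) ?_ hx'
    rintro _ ⟨j, hj, rfl⟩
    exact hfg j hj
  have supp {i j : ℕ} (hij : i < j) (x) : ∀ l ∈ ((X i).v x).support, l < (X j).n :=
    fun l hl => ((hX i).support_lt x l hl).trans_le (hn.monotone (Nat.succ_le_of_lt hij))
  have u_succ (i) (x : ℕ →₀ A) (hx : ∀ l ∈ x.support, l < (X i).n) :
      (X (i + 1)).u ((X i).v ((X i).u x)) = (X (i + 1)).u x :=
    ext_of_support ((X (i + 1)).u ∘ₗ (X i).v ∘ₗ (X i).u) (X (i + 1)).u (X i).n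
      (hX i).u_v_u x hx
  have uvu {i j l : ℕ} (hij : i < j) (hjl : j < l) (x) :
      (X l).u ((X j).v ((X j).u ((X i).v x))) = (X l).u ((X i).v x) := by
    induction l, hjl using Nat.le_induction with
    | base => exact u_succ j _ (supp hij x)
    | succ l hjl ih =>
      rw [← u_succ l _ (supp hjl _), ih, u_succ l _ (supp (hij.trans hjl) x)]
  have pvu (j : ℕ) (x : ℕ →₀ A) (hx : ∀ l ∈ x.support, l < (X j).n) :
      p ((X j).v ((X j).u x)) = p x :=
    ext_of_support (p ∘ₗ (X j).v ∘ₗ (X j).u) p (X j).n (X j).p_v_u x hx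
  refine ⟨fun i => (X i).k, ⟨{
    free := fun i => inferInstance
    finite := fun i => inferInstance
    t := fun i j => (X j).u ∘ₗ (X i).v
    g := fun i => p ∘ₗ (X i).v
    t_comp := fun hij hjk => LinearMap.ext fun x => uvu hij hjk x
    g_comp := fun hij => LinearMap.ext fun x => pvu _ _ (supp hij x)
    exists_rep := ?_
    exists_t_eq_zero := ?_ }⟩⟩
  · intro x
    obtain ⟨z, rfl⟩ := hp x
    have hz : ∀ l ∈ z.support, l < (X (z.support.sup id + 1)).n := fun l hl => by
      have h1 : l ≤ z.support.sup id := Finset.le_sup (f := id) hl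
      have h2 : z.support.sup id + 1 ≤ (X (z.support.sup id + 1)).n := hn.id_le _
      omega
    refine ⟨z.support.sup id + 1, (X (z.support.sup id + 1)).u z, ?_⟩
    exact pvu (z.support.sup id + 1) z hz
  · intro i x hx
    have hmem : (X i).v x ∈ Submodule.span A (Set.range r) := hr' ▸ hx
    obtain ⟨c, hc⟩ := Finsupp.mem_span_range_iff_exists_finsupp.1 hmem
    refine ⟨max (c.support.sup id) i + 1, by omega, ?_⟩
    rw [LinearMap.comp_apply, ← hc, map_finsuppSum]
    refine Finset.sum_eq_zero fun l hl => ?_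
    have : l ≤ c.support.sup id := Finset.le_sup (f := id) hl
    change (X (max (c.support.sup id) i + 1)).u (c l • r l) = 0
    rw [map_smul, (hX _).u_r l (by omega), smul_zero]

end Lazard

section Definable

variable {A : Type u} [CommRing A] {F G H : Type u} [AddCommGroup F] [Module A F]
  [AddCommGroup G] [Module A G] [AddCommGroup H] [Module A H]

/-- A map from a finite free module to a direct limit factors through a stage. -/
lemma exists_lift_directLimit [Module.Free A G] [Module.Finite A G] {ι : Type u} [Preorder ι]
    [IsDirected ι (· ≤ ·)] [Nonempty ι] [DecidableEq ι] (X : ι → Type u)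
    [∀ i, AddCommGroup (X i)] [∀ i, Module A (X i)] (f : ∀ i j, i ≤ j → X i →ₗ[A] X j)
    (h : G →ₗ[A] Module.DirectLimit X f) :
    ∃ i, ∃ k : G →ₗ[A] X i, h = Module.DirectLimit.of A ι X f i ∘ₗ k := by
  let b := Module.Free.chooseBasis A G
  choose i x hx using fun e => Module.DirectLimit.exists_of (h (b e))
  obtain ⟨j, hj⟩ := Finite.exists_le i
  refine ⟨j, b.constr A fun e => f (i e) j (hj e) (x e), b.ext fun e => ?_⟩
  rw [LinearMap.comp_apply, Module.Basis.constr_basis, Module.DirectLimit.of_f, hx]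

/-- A map into a pure submodule factors through `β` as soon as it does so in the big module. -/
lemma IsPureMono.exists_factorization [Module.Free A F] [Module.Finite A F] [Module.Free A H]
    [Module.Finite A H] {N : Type u} [AddCommGroup N] [Module A N] {p : Submodule A N}
    (hp : IsPureMono p.subtype) (β : F →ₗ[A] H) (φ : F →ₗ[A] p) (h : H →ₗ[A] N)
    (hφ : p.subtype ∘ₗ φ = h ∘ₗ β) : ∃ k : H →ₗ[A] p, φ = k ∘ₗ β := by
  let β' : Module.Dual A H →ₗ[A] Module.Dual A F := β.dualMap
  have nat {X : Type u} [AddCommGroup X] [Module A X] (w : Module.Dual A H ⊗[A] X) :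
      dualTensorHom A F X (β'.rTensor X w) = dualTensorHom A H X w ∘ₗ β := by
    induction w using TensorProduct.induction_on with
    | zero => simp
    | add x y hx hy => simp only [map_add, hx, hy, LinearMap.add_comp]
    | tmul f x => ext y; simp [β']
  have nat' (z : Module.Dual A F ⊗[A] p) :
      dualTensorHom A F N (p.subtype.lTensor _ z) = p.subtype ∘ₗ dualTensorHom A F p z := by
    induction z using TensorProduct.induction_on with
    | zero => simp
    | add x y hx hy => simp only [map_add, hx, hy, LinearMap.comp_add]
    | tmul f x => ext y; simp
  obtain ⟨z, rfl : dualTensorHom A F p z = φ⟩ := (dualTensorHomEquiv A F p).surjective φ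
  obtain ⟨w, rfl : dualTensorHom A H N w = h⟩ := (dualTensorHomEquiv A H N).surjective h
  rw [← nat, ← nat'] at hφ
  have hzw : p.subtype.lTensor _ z = β'.rTensor N w := (dualTensorHomEquiv A F N).injective hφ
  have hex (X : Type u) [AddCommGroup X] [Module A X] :
      Function.Exact (β'.rTensor X) ((LinearMap.range β').mkQ.rTensor X) :=
    rTensor_exact X (LinearMap.exact_map_mkQ_range β') (Submodule.mkQ_surjective _)
  have h0 : (LinearMap.range β').mkQ.rTensor p z = 0 := by
    have hinj : Function.Injective
        (p.subtype.lTensor (Module.Dual A F ⧸ LinearMap.range β')) := by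
      rw [LinearMap.lTensor_inj_iff_rTensor_inj]
      exact hp _
    apply hinj
    rw [map_zero, ← LinearMap.comp_apply, LinearMap.lTensor_comp_rTensor,
      ← LinearMap.rTensor_comp_lTensor, LinearMap.comp_apply, hzw]
    exact (hex N _).2 ⟨w, rfl⟩
  obtain ⟨w', rfl⟩ := (hex p _).1 h0
  exact ⟨_, nat w'⟩

lemma isDefinableClass_factorsThrough [Module.Free A F] [Module.Finite A F] [Module.Free A G]
    [Module.Finite A G] [Module.Free A H] [Module.Finite A H] (α : F →ₗ[A] G) (β : F →ₗ[A] H) :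
    IsDefinableClass A (fun N _ _ => FactorsThrough α β N) where
  closed_iso N₁ _ _ N₂ _ _ e h φ := by
    obtain ⟨e⟩ := e
    obtain ⟨k, hk⟩ := h (e.symm.toLinearMap ∘ₗ φ)
    refine ⟨e.toLinearMap ∘ₗ k, ?_⟩
    rw [LinearMap.comp_assoc, ← hk]
    ext x
    simp
  closed_prod I N _ _ h φ := by
    choose k hk using fun i => h i (LinearMap.proj i ∘ₗ φ)
    exact ⟨LinearMap.pi k, LinearMap.ext fun x => funext fun i => LinearMap.congr_fun (hk i) x⟩
  closed_directLimit ι _ _ _ X _ _ f _ h φ := by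
    cases isEmpty_or_nonempty ι
    · exact ⟨0, LinearMap.ext fun x => Subsingleton.elim _ _⟩
    obtain ⟨i, ψ, rfl⟩ := exists_lift_directLimit X f φ
    obtain ⟨k, hk⟩ := h i ψ
    exact ⟨Module.DirectLimit.of A ι X f i ∘ₗ k, by
      rw [LinearMap.comp_assoc, hk, LinearMap.comp_assoc]⟩
  closed_pureSubmodule N _ _ p hp h φ := by
    obtain ⟨k, hk⟩ := h (p.subtype ∘ₗ φ)
    exact hp.exists_factorization β (φ ∘ₗ α) k (by rw [← hk, LinearMap.comp_assoc])

lemma LinearMap.lTensor_rTensor_apply {Q Q' : Type u} [AddCommGroup Q] [Module A Q]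
    [AddCommGroup Q'] [Module A Q'] (β : F →ₗ[A] H) (f : Q →ₗ[A] Q') (z : F ⊗[A] Q) :
    β.rTensor Q' (f.lTensor F z) = f.lTensor H (β.rTensor Q z) := by
  rw [← LinearMap.comp_apply, ← LinearMap.comp_apply, LinearMap.rTensor_comp_lTensor,
    LinearMap.lTensor_comp_rTensor]

/-- `KerLE α β` passes to a module with a jointly injective (after tensoring) family of maps. -/
lemma KerLE.of_jointly_injective {α : F →ₗ[A] G} {β : F →ₗ[A] H} {Q : Type u} [AddCommGroup Q]
    [Module A Q] {I : Type*} {N : I → Type u} [∀ i, AddCommGroup (N i)] [∀ i, Module A (N i)]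
    (f : ∀ i, Q →ₗ[A] N i) (hf : ∀ z : G ⊗[A] Q, (∀ i, (f i).lTensor G z = 0) → z = 0)
    (h : ∀ i, KerLE α β (N i)) : KerLE α β Q := by
  intro z hz
  refine hf _ fun i => ?_
  rw [← LinearMap.lTensor_rTensor_apply]
  exact h i _ (by rw [LinearMap.lTensor_rTensor_apply, hz, map_zero])

lemma isDefinableClass_kerLE [Module.Free A G] (α : F →ₗ[A] G) (β : F →ₗ[A] H) :
    IsDefinableClass A (fun N _ _ => KerLE α β N) where
  closed_iso N₁ _ _ N₂ _ _ e h := by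
    obtain ⟨e⟩ := e
    refine KerLE.of_jointly_injective (I := Unit) (fun _ => e.symm.toLinearMap)
      (fun z hz => ?_) (fun _ => h)
    exact (map_eq_zero_iff (LinearEquiv.lTensor G e.symm) (LinearEquiv.injective _)).1 (hz ())
  closed_prod I N _ _ h := by
    refine KerLE.of_jointly_injective (fun i => LinearMap.proj i) (fun z hz => ?_) h
    let b := Module.Free.chooseBasis A G
    have nat (i : I) (z : G ⊗[A] ∀ i, N i) (e) :
        TensorProduct.equivFinsuppOfBasisLeft b ((LinearMap.proj i).lTensor G z) e =
          TensorProduct.equivFinsuppOfBasisLeft b z e i := by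
      induction z using TensorProduct.induction_on with
      | zero => simp
      | add x y hx hy => simp [hx, hy]
      | tmul x y => simp
    apply (TensorProduct.equivFinsuppOfBasisLeft b).injective
    ext e i
    rw [← nat, hz]
    simp
  closed_directLimit ι _ _ _ X _ _ f _ h := by
    intro z hz
    cases isEmpty_or_nonempty ι
    · induction α.rTensor _ z using TensorProduct.induction_on with
      | zero => rfl
      | add x y hx hy => rw [hx, hy, add_zero]
      | tmul x y => rw [Subsingleton.elim y 0, tmul_zero]
    have nat {K : Type u} [AddCommGroup K] [Module A K] (i) (z : K ⊗[A] X i) :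
        TensorProduct.directLimitRight f K ((Module.DirectLimit.of A ι X f i).lTensor K z) =
          Module.DirectLimit.of A ι (fun i => K ⊗[A] X i) (fun i j h => (f i j h).lTensor K)
            i z := by
      induction z using TensorProduct.induction_on with
      | zero => simp
      | add x y hx hy => simp only [map_add, hx, hy]
      | tmul x y => simp
    obtain ⟨i, y, hy⟩ := Module.DirectLimit.exists_of (TensorProduct.directLimitRight f F z)
    rw [← nat] at hy
    obtain rfl := (TensorProduct.directLimitRight f F).injective hy
    rw [LinearMap.lTensor_rTensor_apply] at hz
    have h0 := congrArg (TensorProduct.directLimitRight f H) hz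
    rw [nat, map_zero] at h0
    obtain ⟨j, hij, hj⟩ := Module.DirectLimit.of.zero_exact h0
    have hy' : (Module.DirectLimit.of A ι X f i).lTensor F y =
        (Module.DirectLimit.of A ι X f j).lTensor F ((f i j hij).lTensor F y) := by
      rw [← LinearMap.comp_apply, ← LinearMap.lTensor_comp]
      congr 2
      ext x
      simp [Module.DirectLimit.of_f]
    rw [hy', LinearMap.lTensor_rTensor_apply, h j, map_zero]
    rw [LinearMap.lTensor_rTensor_apply, hj]
  closed_pureSubmodule N _ _ p hp h := by
    refine KerLE.of_jointly_injective (I := Unit) (fun _ => p.subtype)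
      (fun z hz => ?_) (fun _ => h)
    exact (map_eq_zero_iff _ ((LinearMap.lTensor_inj_iff_rTensor_inj _ _).2 (hp G))).1 (hz ())

lemma factorsThrough_characterModule_iff {α : F →ₗ[A] G} {β : F →ₗ[A] H} {Q : Type u}
    [AddCommGroup Q] [Module A Q] : FactorsThrough α β (CharacterModule Q) ↔ KerLE α β Q := by
  constructor
  · intro h z hz
    refine CharacterModule.eq_zero_of_character_apply fun c => ?_
    obtain ⟨k, hk⟩ := h (CharacterModule.curry c)
    have nat : ∀ z, c (α.rTensor Q z) = CharacterModule.uncurry k (β.rTensor Q z) := by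
      intro z
      induction z using TensorProduct.induction_on with
      | zero => simp only [map_zero]
      | add x y hx hy => simp only [map_add, hx, hy]
      | tmul x y => exact DFunLike.congr_fun (LinearMap.congr_fun hk x) y
    rw [nat, hz, map_zero]
  · intro h φ
    let c : CharacterModule (G ⊗[A] Q) := CharacterModule.uncurry φ
    obtain ⟨γ, hγ⟩ : ∃ γ : LinearMap.range (β.rTensor Q) →ₗ[A] G ⊗[A] Q,
        γ ∘ₗ (β.rTensor Q).rangeRestrict = α.rTensor Q := by
      refine ⟨(LinearMap.ker (β.rTensor Q)).liftQ (α.rTensor Q) h ∘ₗ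
        (β.rTensor Q).quotKerEquivRange.symm.toLinearMap, LinearMap.ext fun z => ?_⟩
      have : (β.rTensor Q).quotKerEquivRange.symm ((β.rTensor Q).rangeRestrict z) =
          Submodule.Quotient.mk z := LinearMap.quotKerEquivRange_symm_apply_image _ _ _
      rw [LinearMap.comp_apply, LinearMap.comp_apply, LinearEquiv.coe_coe, this]
      exact Submodule.liftQ_apply _ _ _
    obtain ⟨d, hd⟩ := CharacterModule.dual_surjective_of_injective
      (LinearMap.range (β.rTensor Q)).subtype (Submodule.injective_subtype _)
      (CharacterModule.dual γ c)
    refine ⟨CharacterModule.curry d, ?_⟩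
    ext x y
    have h1 := DFunLike.congr_fun hd ((β.rTensor Q).rangeRestrict (x ⊗ₜ y))
    have h2 := LinearMap.congr_fun hγ (x ⊗ₜ y)
    exact (congrArg c h2).symm.trans h1.symm

end Definable

section DefClosure

variable {A : Type u} [CommRing A] {𝒬 : (N : Type u) → [AddCommGroup N] → [Module A N] → Prop}

lemma isDefinableClass_defClosure : IsDefinableClass A (DefClosure A 𝒬) where
  closed_iso N₁ _ _ N₂ _ _ e h 𝒞 h𝒞 hle := h𝒞.closed_iso N₁ N₂ e (h 𝒞 h𝒞 hle)
  closed_prod I N _ _ h 𝒞 h𝒞 hle := h𝒞.closed_prod I N fun i => h i 𝒞 h𝒞 hle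
  closed_directLimit ι _ _ _ G _ _ f _ h 𝒞 h𝒞 hle :=
    h𝒞.closed_directLimit ι G f inferInstance fun i => h i 𝒞 h𝒞 hle
  closed_pureSubmodule N _ _ p hp h 𝒞 h𝒞 hle := h𝒞.closed_pureSubmodule N p hp (h 𝒞 h𝒞 hle)

lemma dualDefClass_characterModule {Q : Type u} [AddCommGroup Q] [Module A Q] (hQ : 𝒬 Q) :
    DualDefClass A 𝒬 (CharacterModule Q) :=
  fun _ _ hle => hle _ ⟨Q, _, _, hQ, ⟨.refl A _⟩⟩

lemma IsDefinableClass.directSum (h𝒬 : IsDefinableClass A 𝒬) {N : ℕ → Type u}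
    [∀ i, AddCommGroup (N i)] [∀ i, Module A (N i)] (h : ∀ i, 𝒬 (N i)) :
    𝒬 (DirectSum ℕ N) := by
  let ι : DirectSum ℕ N →ₗ[A] ∀ i : ULift.{u} ℕ, N i.down :=
    LinearMap.pi fun i => DirectSum.component A ℕ N i.down
  have nat (P : Type u) [AddCommGroup P] [Module A P] (z : DirectSum ℕ N ⊗[A] P) (i : ℕ) :
      TensorProduct.directSumLeft A A N P z i =
        (DirectSum.component A ℕ N i).rTensor P z := by
    induction z using TensorProduct.induction_on with
    | zero => simp
    | add x y hx hy => simp [hx, hy]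
    | tmul x y => exact TensorProduct.directSumLeft_tmul ..
  have hι (P : Type u) [AddCommGroup P] [Module A P] : Function.Injective (ι.rTensor P) := by
    refine (injective_iff_map_eq_zero _).2 fun z hz => ?_
    apply (TensorProduct.directSumLeft A A N P).injective
    refine DFinsupp.ext fun i => ?_
    rw [nat, map_zero]
    have : DirectSum.component A ℕ N i =
        (LinearMap.proj (ULift.up.{u} i) : (∀ i : ULift.{u} ℕ, N i.down) →ₗ[A] N i) ∘ₗ ι := rfl
    rw [this, LinearMap.rTensor_comp_apply, hz, map_zero]
    rfl
  have hinj : Function.Injective ι := fun x y hxy => by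
    refine DFinsupp.ext fun i => congrFun hxy (ULift.up i)
  let e := LinearEquiv.ofInjective ι hinj
  refine h𝒬.closed_iso (LinearMap.range ι) _ ⟨e.symm⟩ (h𝒬.closed_pureSubmodule _ _ ?_
    (h𝒬.closed_prod _ _ fun i => h i.down))
  intro P _ _ x y hxy
  obtain ⟨x, rfl⟩ := (LinearEquiv.rTensor P e).surjective x
  obtain ⟨y, rfl⟩ := (LinearEquiv.rTensor P e).surjective y
  have key (z) : (LinearMap.range ι).subtype.rTensor P (LinearEquiv.rTensor P e z) =
      ι.rTensor P z :=
    (LinearMap.rTensor_comp_apply P (LinearMap.range ι).subtype e.toLinearMap z).symm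
  rw [key, key] at hxy
  rw [hι P hxy]

end DefClosure

namespace FreeTelescope

section

variable {A : Type u} [CommRing A] {M : Type u} [AddCommGroup M] [Module A M]
    {F : ℕ → Type u} [∀ i, AddCommGroup (F i)] [∀ i, Module A (F i)]

/-- The telescope stabilizes, uniformly on the class `𝒬`: for each `n` there is `m > n` such
that elements of `F n ⊗ Q` killed at a stage `k > m` are already killed at stage `m`. -/
def UniformlyStable (T : FreeTelescope A M F)
    (𝒬 : (N : Type u) → [AddCommGroup N] → [Module A N] → Prop) : Prop :=
  ∀ n, ∃ m, n < m ∧ ∀ k, m < k → ∀ (Q : Type u) [AddCommGroup Q] [Module A Q], 𝒬 Q →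
    KerLE (T.t n m) (T.t n k) Q

variable {𝒬 : (N : Type u) → [AddCommGroup N] → [Module A N] → Prop}

lemma UniformlyStable.ext1Vanishes {T : FreeTelescope A M F} (h : T.UniformlyStable 𝒬)
    {B : Type u} [AddCommGroup B] [Module A B] (hB : DualDefClass A 𝒬 B) :
    Ext1Vanishes A M B := by
  choose m hm hker using h
  let σ : ℕ → ℕ := fun i => m^[i] 0
  have hσs (i : ℕ) : σ (i + 1) = m (σ i) := Function.iterate_succ_apply' m i 0
  have hσ : StrictMono σ := strictMono_nat_of_lt_succ fun i => by rw [hσs]; exact hm _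
  refine (T.reindex σ hσ).ext1Vanishes_of_factorsThrough fun i => ?_
  have := T.free
  have := T.finite
  refine hB _ (isDefinableClass_factorsThrough (T.t (σ i) (σ (i + 1))) (T.t (σ i) (σ (i + 2)))) ?_
  rintro N _ _ ⟨Q, _, _, hQ, ⟨e⟩⟩
  refine (isDefinableClass_factorsThrough _ _).closed_iso _ _ ⟨e.symm⟩
    (factorsThrough_characterModule_iff.2 ?_)
  have hlt := hσ (Nat.lt_succ_self (i + 1))
  change KerLE (T.t (σ i) (σ (i + 1))) (T.t (σ i) (σ (i + 2))) Q
  rw [hσs i] at hlt ⊢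
  exact hker _ _ hlt Q hQ

lemma uniformlyStable_of_ext1Vanishes (T : FreeTelescope A M F)
    (h : ∀ (B : Type u) [AddCommGroup B] [Module A B], DualDefClass A 𝒬 B → Ext1Vanishes A M B) :
    T.UniformlyStable 𝒬 := by
  by_contra hT
  simp only [UniformlyStable, not_forall, not_exists, not_and] at hT
  obtain ⟨n, hn⟩ := hT
  have hbad (m : ℕ) : ∃ k, m < k ∧ ∃ (Q : Type u) (_ : AddCommGroup Q) (_ : Module A Q),
      𝒬 Q ∧ (n < m → ¬ KerLE (T.t n m) (T.t n k) Q) := by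
    obtain ⟨k, hk, Q, _, _, hQ, hnot⟩ := hn (max m (n + 1)) (by omega)
    refine ⟨k, by omega, Q, _, _, hQ, fun hm => ?_⟩
    rwa [max_eq_left (show n + 1 ≤ m from hm)] at hnot
  choose k hk Q _ _ hQ hnot using hbad
  let σ : ℕ → ℕ := fun i => k^[i] n
  have hσs (i : ℕ) : σ (i + 1) = k (σ i) := Function.iterate_succ_apply' k i n
  have hσ : StrictMono σ := strictMono_nat_of_lt_succ fun i => by rw [hσs]; exact hk _
  obtain ⟨j, hj, hfac⟩ := (T.reindex σ hσ).exists_factorsThrough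
    (fun i => CharacterModule (Q (σ i)))
    (h _ (isDefinableClass_defClosure.directSum fun i => dualDefClass_characterModule (hQ _)))
  refine hnot (σ j) (hσ hj) ?_
  rw [← hσs]
  exact factorsThrough_characterModule_iff.1 hfac

lemma forall_ext1Vanishes_iff (T : FreeTelescope A M F) :
    (∀ (B : Type u) [AddCommGroup B] [Module A B], DualDefClass A 𝒬 B → Ext1Vanishes A M B) ↔
      T.UniformlyStable 𝒬 :=
  ⟨T.uniformlyStable_of_ext1Vanishes, fun h _ _ _ hB => h.ext1Vanishes hB⟩

end

end FreeTelescope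

section BaseChange

variable {R : Type u} (S : Type u) [CommRing R] [CommRing S] [Algebra R S]

lemma exists_baseChange_ker_of_baseChange_eq_zero [Module.Flat R S] {X Y : Type u} [AddCommGroup X]
    [Module R X] [AddCommGroup Y] [Module R Y] {f : X →ₗ[R] Y} {z : S ⊗[R] X}
    (hz : f.baseChange S z = 0) :
    ∃ w : S ⊗[R] LinearMap.ker f, (LinearMap.ker f).subtype.baseChange S w = z :=
  (Module.Flat.lTensor_exact S (LinearMap.exact_subtype_ker_map f) z).1 hz

variable {F G H Q : Type u} [AddCommGroup F] [Module R F] [AddCommGroup G] [Module R G]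
  [AddCommGroup H] [Module R H] [AddCommGroup Q] [Module R Q]

lemma distribBaseChange_rTensor (β : F →ₗ[R] H) (w : S ⊗[R] (F ⊗[R] Q)) :
    TensorProduct.AlgebraTensorModule.distribBaseChange R S H Q
      ((β.rTensor Q).baseChange S w) =
    (β.baseChange S).rTensor (S ⊗[R] Q)
      (TensorProduct.AlgebraTensorModule.distribBaseChange R S F Q w) := by
  induction w using TensorProduct.induction_on with
  | zero => simp only [map_zero]
  | add x y hx hy => simp only [map_add, hx, hy]
  | tmul s z =>
    induction z using TensorProduct.induction_on with
    | zero => simp only [tmul_zero, map_zero]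
    | add x y hx hy => simp only [tmul_add, map_add, hx, hy]
    | tmul x y => simp [TensorProduct.AlgebraTensorModule.distribBaseChange_tmul]

lemma kerLE_baseChange_iff [Module.FaithfullyFlat R S] {α : F →ₗ[R] G} {β : F →ₗ[R] H} :
    KerLE (α.baseChange S) (β.baseChange S) (S ⊗[R] Q) ↔ KerLE α β Q := by
  constructor
  · intro h z hz
    apply Module.FaithfullyFlat.tensorProduct_mk_injective (A := R) (B := S) (G ⊗[R] Q)
    apply (TensorProduct.AlgebraTensorModule.distribBaseChange R S G Q).injective
    have := h (TensorProduct.AlgebraTensorModule.distribBaseChange R S F Q (1 ⊗ₜ z))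
    rw [← distribBaseChange_rTensor, ← distribBaseChange_rTensor, LinearMap.baseChange_tmul,
      LinearMap.baseChange_tmul, hz, tmul_zero, map_zero] at this
    rw [TensorProduct.mk_apply, this rfl, map_zero, map_zero]
  · intro h z hz
    obtain ⟨z, rfl⟩ := (TensorProduct.AlgebraTensorModule.distribBaseChange R S F Q).surjective z
    rw [← distribBaseChange_rTensor, LinearEquiv.map_eq_zero_iff] at hz
    obtain ⟨w, rfl⟩ := exists_baseChange_ker_of_baseChange_eq_zero S hz
    rw [← distribBaseChange_rTensor, LinearEquiv.map_eq_zero_iff]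
    rw [← LinearMap.comp_apply, ← LinearMap.baseChange_comp]
    have : α.rTensor Q ∘ₗ (LinearMap.ker (β.rTensor Q)).subtype = 0 :=
      LinearMap.ext fun x => h x.1 x.2
    rw [this, LinearMap.baseChange_zero, LinearMap.zero_apply]

namespace FreeTelescope

variable {M : Type u} [AddCommGroup M] [Module R M]
    {F : ℕ → Type u} [∀ i, AddCommGroup (F i)] [∀ i, Module R (F i)]

/-- Extension of scalars of a telescope along a flat ring map. -/
def baseChange [Module.Flat R S] (T : FreeTelescope R M F) :
    FreeTelescope S (S ⊗[R] M) (fun i => S ⊗[R] F i) where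
  free i := have := T.free i; inferInstance
  finite i := have := T.finite i; inferInstance
  t i j := (T.t i j).baseChange S
  g i := (T.g i).baseChange S
  t_comp hij hjk := by rw [← LinearMap.baseChange_comp, T.t_comp hij hjk]
  g_comp hij := by rw [← LinearMap.baseChange_comp, T.g_comp hij]
  exists_rep x := by
    have push {i j : ℕ} (hij : i < j) (y : S ⊗[R] F i) :
        (T.g j).baseChange S ((T.t i j).baseChange S y) = (T.g i).baseChange S y := by
      rw [← LinearMap.comp_apply, ← LinearMap.baseChange_comp, T.g_comp hij]
    induction x using TensorProduct.induction_on with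
    | zero => exact ⟨0, 0, map_zero _⟩
    | add x y hx hy =>
      obtain ⟨i, x, rfl⟩ := hx
      obtain ⟨j, y, rfl⟩ := hy
      refine ⟨max i j + 1, (T.t i _).baseChange S x + (T.t j _).baseChange S y, ?_⟩
      rw [map_add, push (by omega), push (by omega)]
    | tmul s x =>
      obtain ⟨i, y, rfl⟩ := T.exists_rep x
      exact ⟨i, s ⊗ₜ y, LinearMap.baseChange_tmul ..⟩
  exists_t_eq_zero i x hx := by
    obtain ⟨w, rfl⟩ := exists_baseChange_ker_of_baseChange_eq_zero S hx
    clear hx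
    have push {j k : ℕ} (hij : i < j) (hjk : j < k) {y : S ⊗[R] F i}
        (hy : (T.t i j).baseChange S y = 0) : (T.t i k).baseChange S y = 0 := by
      rw [← T.t_comp hij hjk, LinearMap.baseChange_comp, LinearMap.comp_apply, hy, map_zero]
    induction w using TensorProduct.induction_on with
    | zero => exact ⟨i + 1, by omega, by simp only [map_zero]⟩
    | add x y hx hy =>
      obtain ⟨j, hj, hx⟩ := hx
      obtain ⟨k, hk, hy⟩ := hy
      refine ⟨max j k + 1, by omega, ?_⟩
      rw [map_add, map_add, push hj (by omega) hx, push hk (by omega) hy, add_zero]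
    | tmul s x =>
      obtain ⟨j, hij, hj⟩ := T.exists_t_eq_zero i x.1 x.2
      refine ⟨j, hij, ?_⟩
      rw [LinearMap.baseChange_tmul, LinearMap.baseChange_tmul, Submodule.subtype_apply, hj,
        tmul_zero]

lemma uniformlyStable_baseChange_iff [Module.FaithfullyFlat R S] (T : FreeTelescope R M F)
    {𝒬 : (N : Type u) → [AddCommGroup N] → [Module R N] → Prop} :
    (T.baseChange S).UniformlyStable (DefClosure S (BaseChangeClass R S 𝒬)) ↔
      T.UniformlyStable 𝒬 := by
  refine forall_congr' fun n => exists_congr fun m => and_congr_right fun _ =>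
    forall_congr' fun k => imp_congr_right fun _ => ⟨fun h Q _ _ hQ => ?_, fun h N _ _ hN => ?_⟩
  · exact (kerLE_baseChange_iff S).1
      (h (S ⊗[R] Q) fun _ _ hle => hle _ ⟨Q, _, _, hQ, ⟨.refl S _⟩⟩)
  · have := (T.baseChange S).free
    refine hN _ (isDefinableClass_kerLE _ _) ?_
    rintro N _ _ ⟨Q, _, _, hQ, ⟨e⟩⟩
    exact (isDefinableClass_kerLE _ _).closed_iso _ _ ⟨e.symm⟩
      ((kerLE_baseChange_iff S).2 (h Q hQ))

end FreeTelescope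

end BaseChange

/-- Let `φ : R → S` be faithfully flat, `𝒬` a definable class of `R`-modules
with dual class `ℬ = 𝒬^∨`, `𝒬'` the least definable class of `S`-modules containing
`𝒬 ⊗[R] S`, and `ℬ'` the dual class of `𝒬'`. For a countably presented flat `R`-module `M`:
`Ext¹_R(M, B) = 0` for all `B ∈ ℬ` iff `Ext¹_S(M ⊗[R] S, B') = 0` for all `B' ∈ ℬ'`. -/
theorem stmt_9 (R S : Type u) [CommRing R] [CommRing S] [Algebra R S] [Module.FaithfullyFlat R S]
    (𝒬 : (N : Type u) → [AddCommGroup N] → [Module R N] → Prop) (hdef : IsDefinableClass R 𝒬)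
    (M : Type u) [AddCommGroup M] [Module R M]
    (hcp : CountablyPresented R M) (hflat : Module.Flat R M) :
    (∀ (B : Type u) [AddCommGroup B] [Module R B], DualDefClass R 𝒬 B →
        Ext1Vanishes R M B) ↔
      (∀ (B' : Type u) [AddCommGroup B'] [Module S B'],
        DualDefClass S (DefClosure S (BaseChangeClass R S 𝒬)) B' →
          Ext1Vanishes S (S ⊗[R] M) B') := by
  obtain ⟨k, ⟨T⟩⟩ := exists_freeTelescope hcp
  rw [T.forall_ext1Vanishes_iff, (T.baseChange S).forall_ext1Vanishes_iff,
    T.uniformlyStable_baseChange_iff S]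

end
end

section
/- Let φ : R → S be a flat homomorphism of commutative rings, C_R a class of R-modules, and C_S a class of S-modules such that C_R ⊗_R S ⊆ C_S. If M is a flat Def(C_R^⊺)-Mittag-Leffler R-module, then M ⊗_R S is a flat Def(C_S^⊺)-Mittag-Leffler S-module. -/
open TensorProduct CategoryTheory

universe u

noncomputable section

section Tor

variable {A : Type u} [CommRing A]

/-- If `P₂ → P₁ → P₀ → D` is exact, then `N ⊗ P₂ → N ⊗ P₁ → N ⊗ P₀` is exact if and only if
`N ⊗ ker (P₀ → D) → N ⊗ P₀` is injective. -/
lemma lTensor_exact_iff_injective_lTensor_ker {P₂ P₁ P₀ D : Type*}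
    [AddCommGroup P₂] [Module A P₂] [AddCommGroup P₁] [Module A P₁]
    [AddCommGroup P₀] [Module A P₀] [AddCommGroup D] [Module A D]
    {d₂ : P₂ →ₗ[A] P₁} {d₁ : P₁ →ₗ[A] P₀} {π : P₀ →ₗ[A] D}
    (h₁ : Function.Exact d₂ d₁) (h₀ : Function.Exact d₁ π)
    (N : Type*) [AddCommGroup N] [Module A N] :
    Function.Exact (d₂.lTensor N) (d₁.lTensor N) ↔
      Function.Injective ((LinearMap.ker π).subtype.lTensor N) := by
  let q : P₁ →ₗ[A] LinearMap.ker π := d₁.codRestrict _ fun x => h₀.apply_apply_eq_zero x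
  have hq : Function.Surjective q := by
    rintro ⟨x, hx⟩
    obtain ⟨y, rfl⟩ := (h₀ x).1 hx
    exact ⟨y, rfl⟩
  have hdq : d₁ = (LinearMap.ker π).subtype ∘ₗ q := rfl
  have hex : Function.Exact d₂ q := fun x => by
    rw [← h₁ x, Subtype.ext_iff]
    rfl
  have hexN : Function.Exact (d₂.lTensor N) (q.lTensor N) := lTensor_exact N hex hq
  have hqN := LinearMap.lTensor_surjective N hq
  rw [hdq, LinearMap.lTensor_comp, injective_iff_map_eq_zero]
  constructor
  · intro h x hx
    obtain ⟨y, rfl⟩ := hqN x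
    exact (hexN y).2 ((h y).1 hx)
  · intro h y
    rw [← hexN y]
    exact ⟨fun hy => h _ hy, fun hy => by simp [hy]⟩

/-- Every module `D` is a quotient `P → D` of a projective module such that
`Tor₁(N, D) = 0` if and only if `N ⊗ ker (P → D) → N ⊗ P` is injective. -/
lemma exists_projective_tor1Vanishes_iff (D : Type u) [AddCommGroup D] [Module A D] :
    ∃ (P : Type u) (_ : AddCommGroup P) (_ : Module A P) (π : P →ₗ[A] D),
      Module.Projective A P ∧ Function.Surjective π ∧
      ∀ (N : Type u) [AddCommGroup N] [Module A N],
        Tor1Vanishes A N D ↔ Function.Injective ((LinearMap.ker π).subtype.lTensor N) := by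
  let Q := projectiveResolution (ModuleCat.of A D)
  let π := Q.π.f 0 ≫ (HomologicalComplex.singleObjXSelf _ 0 (ModuleCat.of A D)).hom
  have hπ : Epi π := inferInstance
  have h₀ : Function.Exact (Q.complex.d 1 0).hom π.hom := by
    have hw : Q.complex.d 1 0 ≫ π = 0 := by
      rw [← Category.assoc, Q.complex_d_comp_π_f_zero, Limits.zero_comp]
    refine (ShortComplex.ShortExact.moduleCat_exact_iff_function_exact
      (ShortComplex.mk _ _ hw)).1 ((ShortComplex.exact_iff_of_iso ?_).1 Q.exact₀)
    exact ShortComplex.isoMk (Iso.refl _) (Iso.refl _)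
      (HomologicalComplex.singleObjXSelf _ 0 (ModuleCat.of A D)) (by simp) (Category.id_comp _)
  have h₁ : Function.Exact (Q.complex.d 2 1).hom (Q.complex.d 1 0).hom :=
    (ShortComplex.ShortExact.moduleCat_exact_iff_function_exact _).1 (Q.exact_succ 0)
  refine ⟨Q.complex.X 0, inferInstance, inferInstance, π.hom, ?_, ?_, fun N _ _ => ?_⟩
  · exact (IsProjective.iff_projective (R := A) (Q.complex.X 0)).2
      (inferInstanceAs (Projective (Q.complex.X 0)))
  · exact (ModuleCat.epi_iff_surjective _).1 hπ
  rw [← lTensor_exact_iff_injective_lTensor_ker h₁ h₀ N]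
  let F := (MonoidalCategory.tensoringLeft (ModuleCat.{u} A)).obj (ModuleCat.of A N)
  let e := Q.isoLeftDerivedObj F 1
  change Subsingleton ↑((F.leftDerived 1).obj (ModuleCat.of A D)) ↔ _
  rw [← ModuleCat.isZero_iff_subsingleton, e.isZero_iff]
  change Limits.IsZero (HomologicalComplex.homology _ 1) ↔ _
  rw [← HomologicalComplex.exactAt_iff_isZero_homology,
    HomologicalComplex.exactAt_iff' _ 2 1 0 (by simp) (by simp),
    ShortComplex.ShortExact.moduleCat_exact_iff_function_exact]
  rfl

/-- Injectivity of `N ⊗ ker (F → D) → N ⊗ F` for some flat cover `F → D` implies injectivity of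
`N ⊗ ker (F' → D) → N ⊗ F'` for every surjection `F' → D`. -/
lemma injective_lTensor_ker_of_flat {F F' D : Type*}
    [AddCommGroup F] [Module A F] [AddCommGroup F'] [Module A F'] [AddCommGroup D] [Module A D]
    [Module.Flat A F] (f : F →ₗ[A] D) (hf : Function.Surjective f)
    (f' : F' →ₗ[A] D) (hf' : Function.Surjective f')
    (N : Type*) [AddCommGroup N] [Module A N]
    (h : Function.Injective ((LinearMap.ker f).subtype.lTensor N)) :
    Function.Injective ((LinearMap.ker f').subtype.lTensor N) := by
  let E := LinearMap.eqLocus (f ∘ₗ LinearMap.fst A F F') (f' ∘ₗ LinearMap.snd A F F')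
  let p : E →ₗ[A] F := LinearMap.fst A F F' ∘ₗ E.subtype
  let p' : E →ₗ[A] F' := LinearMap.snd A F F' ∘ₗ E.subtype
  let i : LinearMap.ker f →ₗ[A] E :=
    (LinearMap.inl A F F' ∘ₗ (LinearMap.ker f).subtype).codRestrict E fun x => by simp [E]
  let i' : LinearMap.ker f' →ₗ[A] E :=
    (LinearMap.inr A F F' ∘ₗ (LinearMap.ker f').subtype).codRestrict E fun x => by simp [E]
  have hp : Function.Surjective p := fun x => by
    obtain ⟨y, hy⟩ := hf' (f x)
    exact ⟨⟨(x, y), hy.symm⟩, rfl⟩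
  have hp' : Function.Surjective p' := fun y => by
    obtain ⟨x, hx⟩ := hf (f' y)
    exact ⟨⟨(x, y), hx⟩, rfl⟩
  have hi' : Function.Injective i' := fun x y hxy => by
    ext
    exact congrArg (fun z : E => z.1.2) hxy
  have hexact' : Function.Exact i p' := by
    rintro ⟨⟨x, y⟩, hxy⟩
    change y = 0 ↔ _
    constructor
    · rintro rfl
      exact ⟨⟨x, by simpa [E] using hxy⟩, rfl⟩
    · rintro ⟨z, hz⟩
      exact (congrArg (fun z : E => z.1.2) hz).symm
  have hexact : Function.Exact i' p := by
    rintro ⟨⟨x, y⟩, hxy⟩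
    change x = 0 ↔ _
    constructor
    · rintro rfl
      exact ⟨⟨y, by simpa [E] using Eq.symm hxy⟩, rfl⟩
    · rintro ⟨z, hz⟩
      exact (congrArg (fun z : E => z.1.1) hz).symm
  have hinj : Function.Injective (i'.lTensor N) :=
    LinearMap.lTensor_injective_of_exact_of_flat p hp i' hi' hexact N
  have hpi : p ∘ₗ i = (LinearMap.ker f).subtype := rfl
  have hpi' : p' ∘ₗ i' = (LinearMap.ker f').subtype := rfl
  have hzero : p ∘ₗ i' = 0 := rfl
  rw [injective_iff_map_eq_zero] at h ⊢
  intro x hx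
  rw [← hpi', LinearMap.lTensor_comp_apply] at hx
  obtain ⟨y, hy⟩ := (lTensor_exact N hexact' hp' _).1 hx
  have hy0 : y = 0 := by
    apply h
    rw [← hpi, LinearMap.lTensor_comp_apply, hy, ← LinearMap.lTensor_comp_apply, hzero]
    simp
  apply hinj
  rw [← hy, hy0, map_zero, map_zero]

end Tor

section BaseChange

variable {R S : Type u} [CommRing R] [CommRing S] [Algebra R S]

/-- The isomorphism `(S ⊗[R] C) ⊗[S] Z ≃ C ⊗[R] Z` for an `S`-module `Z`. -/
def baseChangeTensorEquiv (R S : Type u) [CommRing R] [CommRing S] [Algebra R S]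
    (C Z : Type*) [AddCommGroup C] [Module R C] [AddCommGroup Z] [Module R Z] [Module S Z]
    [IsScalarTower R S Z] : (S ⊗[R] C) ⊗[S] Z ≃ₗ[R] C ⊗[R] Z :=
  (TensorProduct.comm S (S ⊗[R] C) Z).restrictScalars R ≪≫ₗ
    (AlgebraTensorModule.cancelBaseChange R S S Z C).restrictScalars R ≪≫ₗ
      TensorProduct.comm R Z C

lemma baseChangeTensorEquiv_lTensor {X Y C : Type*} [AddCommGroup X] [Module R X]
    [Module S X] [IsScalarTower R S X] [AddCommGroup Y] [Module R Y] [Module S Y]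
    [IsScalarTower R S Y] [AddCommGroup C] [Module R C] (g : X →ₗ[S] Y)
    (x : (S ⊗[R] C) ⊗[S] X) :
    baseChangeTensorEquiv R S C Y (g.lTensor (S ⊗[R] C) x) =
      (g.restrictScalars R).lTensor C (baseChangeTensorEquiv R S C X x) := by
  induction x with
  | zero => simp
  | add x y hx hy => simp only [map_add, hx, hy]
  | tmul t z =>
    induction t with
    | zero => simp
    | add t t' ht ht' => simp only [add_tmul, map_add, ht, ht']
    | tmul s c => simp [baseChangeTensorEquiv]

/-- For an `S`-linear map `X → Y`, the map `C ⊗[R] X → C ⊗[R] Y` is injective if and only if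
`(S ⊗[R] C) ⊗[S] X → (S ⊗[R] C) ⊗[S] Y` is. -/
lemma injective_lTensor_restrictScalars_iff {X Y C : Type*} [AddCommGroup X] [Module R X]
    [Module S X] [IsScalarTower R S X] [AddCommGroup Y] [Module R Y] [Module S Y]
    [IsScalarTower R S Y] [AddCommGroup C] [Module R C] (g : X →ₗ[S] Y) :
    Function.Injective ((g.restrictScalars R).lTensor C) ↔
      Function.Injective (g.lTensor (S ⊗[R] C)) := by
  rw [← (baseChangeTensorEquiv R S C Y).injective.of_comp_iff,
    ← Function.Injective.of_comp_iff' _ (baseChangeTensorEquiv R S C X).bijective]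
  refine iff_of_eq (congrArg _ (funext fun x => ?_))
  exact (baseChangeTensorEquiv_lTensor g x).symm

/-- A pure monomorphism of `S`-modules is a pure monomorphism of `R`-modules. -/
lemma IsPureMono.restrictScalars {X Y : Type u} [AddCommGroup X] [Module R X]
    [Module S X] [IsScalarTower R S X] [AddCommGroup Y] [Module R Y] [Module S Y]
    [IsScalarTower R S Y] {g : X →ₗ[S] Y} (hg : IsPureMono g) :
    IsPureMono (g.restrictScalars R) := fun P _ _ => by
  rw [← LinearMap.lTensor_inj_iff_rTensor_inj, injective_lTensor_restrictScalars_iff,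
    LinearMap.lTensor_inj_iff_rTensor_inj]
  exact hg _

/-- If `Tor₁^S(S ⊗[R] C, D) = 0` then `Tor₁^R(C, D) = 0`, provided `S` is flat over `R`. -/
lemma Tor1Vanishes.of_baseChange [Module.Flat R S] {C D : Type u} [AddCommGroup C] [Module R C]
    [AddCommGroup D] [Module R D] [Module S D] [IsScalarTower R S D]
    (h : Tor1Vanishes S (S ⊗[R] C) D) : Tor1Vanishes R C D := by
  obtain ⟨P, _, _, π, _, hπ, hP⟩ := exists_projective_tor1Vanishes_iff (A := S) D
  obtain ⟨P', _, _, π', _, hπ', hP'⟩ := exists_projective_tor1Vanishes_iff (A := R) D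
  let _ : Module R P := Module.compHom P (algebraMap R S)
  have : IsScalarTower R S P := IsScalarTower.of_compHom R S P
  have : Module.Flat R P := Module.Flat.trans R S P
  rw [hP']
  have hinj : Function.Injective (((LinearMap.ker π).subtype.restrictScalars R).lTensor C) :=
    injective_lTensor_restrictScalars_iff _ |>.2 ((hP _).1 h)
  exact injective_lTensor_ker_of_flat (π.restrictScalars R) hπ π' hπ' C hinj

variable {𝒞 : (N : Type u) → [AddCommGroup N] → [Module R N] → Prop}

/-- A definable class of `R`-modules is invariant under `S`-linear isomorphisms. -/
lemma IsDefinableClass.of_linearEquiv (h𝒞 : IsDefinableClass R 𝒞) {N₁ N₂ : Type u}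
    [AddCommGroup N₁] {_ : Module R N₁} [Module S N₁] (_ : IsScalarTower R S N₁)
    [AddCommGroup N₂] {_ : Module R N₂} [Module S N₂] (_ : IsScalarTower R S N₂)
    (e : N₁ ≃ₗ[S] N₂) (h : 𝒞 N₁) : 𝒞 N₂ :=
  h𝒞.closed_iso N₁ N₂ ⟨e.restrictScalars R⟩ h

/-- Restriction of scalars commutes with direct limits. -/
lemma nonempty_directLimit_restrictScalars_equiv {ι : Type u} [Preorder ι]
    [IsDirected ι (· ≤ ·)] [DecidableEq ι] (G : ι → Type u) [∀ i, AddCommGroup (G i)]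
    [∀ i, Module R (G i)] [∀ i, Module S (G i)] [∀ i, IsScalarTower R S (G i)]
    (f : ∀ i j, i ≤ j → G i →ₗ[S] G j) [DirectedSystem G (fun i j h => f i j h)]
    [Module R (Module.DirectLimit G f)] [IsScalarTower R S (Module.DirectLimit G f)] :
    Nonempty (Module.DirectLimit G (fun i j h => (f i j h).restrictScalars R) ≃ₗ[R]
      Module.DirectLimit G f) := by
  let L : Module.DirectLimit G (fun i j h => (f i j h).restrictScalars R) →ₗ[R]
      Module.DirectLimit G f :=
    Module.DirectLimit.lift R ι G _
      (fun i => (Module.DirectLimit.of S ι G f i).restrictScalars R)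
      (fun i j hij x => Module.DirectLimit.of_f)
  have hL (i : ι) (x : G i) : L (Module.DirectLimit.of R ι G _ i x) =
      Module.DirectLimit.of S ι G f i x := Module.DirectLimit.lift_of _ _ _
  cases isEmpty_or_nonempty ι
  · exact ⟨LinearEquiv.ofBijective L ⟨Function.injective_of_subsingleton _,
      Function.surjective_to_subsingleton _⟩⟩
  refine ⟨LinearEquiv.ofBijective L ⟨(injective_iff_map_eq_zero _).2 fun z hz => ?_, fun z => ?_⟩⟩
  · obtain ⟨i, x, rfl⟩ := Module.DirectLimit.exists_of z
    rw [hL] at hz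
    obtain ⟨j, hij, hj⟩ := Module.DirectLimit.of.zero_exact hz
    rw [← Module.DirectLimit.of_f (hij := hij), LinearMap.restrictScalars_apply, hj, map_zero]
  · obtain ⟨i, x, rfl⟩ := Module.DirectLimit.exists_of z
    exact ⟨_, hL i x⟩

/-- The `S`-modules whose underlying `R`-module lies in a definable class of `R`-modules form a
definable class. -/
lemma IsDefinableClass.restrictScalars (h𝒞 : IsDefinableClass R 𝒞) :
    IsDefinableClass S (fun N _ _ => ∀ [Module R N] [IsScalarTower R S N], 𝒞 N) where
  closed_iso N₁ _ _ N₂ _ _ := by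
    rintro ⟨e⟩ h _ _
    let _ : Module R N₁ := Module.compHom N₁ (algebraMap R S)
    have : IsScalarTower R S N₁ := IsScalarTower.of_compHom R S N₁
    exact h𝒞.of_linearEquiv ‹_› ‹_› e h
  closed_prod I N _ _ h := by
    let _ (i : I) : Module R (N i) := Module.compHom (N i) (algebraMap R S)
    have (i : I) : IsScalarTower R S (N i) := IsScalarTower.of_compHom R S (N i)
    have hprod : 𝒞 (∀ i, N i) := h𝒞.closed_prod I N fun i => h i
    have htower : IsScalarTower R S (∀ i, N i) := inferInstance
    intro _ _
    exact h𝒞.of_linearEquiv htower ‹_› (LinearEquiv.refl S (∀ i, N i)) hprod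
  closed_directLimit ι _ _ _ G _ _ f _ h := by
    intro _ _
    let _ (i : ι) : Module R (G i) := Module.compHom (G i) (algebraMap R S)
    have (i : ι) : IsScalarTower R S (G i) := IsScalarTower.of_compHom R S (G i)
    have hsys : DirectedSystem G (fun i j h => (f i j h).restrictScalars R) :=
      ‹DirectedSystem G (fun i j h => f i j h)›
    exact h𝒞.closed_iso _ _ (nonempty_directLimit_restrictScalars_equiv G f)
      (h𝒞.closed_directLimit ι G (fun i j h => (f i j h).restrictScalars R) hsys fun i => h i)
  closed_pureSubmodule N _ _ p hp h := by
    let _ : Module R N := Module.compHom N (algebraMap R S)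
    have : IsScalarTower R S N := IsScalarTower.of_compHom R S N
    have hpure : IsPureMono (p.subtype.restrictScalars R) := hp.restrictScalars
    have hsub : 𝒞 (p.restrictScalars R) :=
      h𝒞.closed_pureSubmodule N (p.restrictScalars R) hpure h
    have htower : IsScalarTower R S p := inferInstance
    intro _ _
    exact h𝒞.of_linearEquiv htower ‹_› (LinearEquiv.refl S p) hsub

/-- Relative Mittag-Leffler modules are stable under base change. -/
lemma IsRelMittagLeffler.baseChange {M : Type u} [AddCommGroup M] [Module R M]
    {𝒬 : (N : Type u) → [AddCommGroup N] → [Module R N] → Prop}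
    (hM : IsRelMittagLeffler R M 𝒬) :
    IsRelMittagLeffler S (S ⊗[R] M)
      (fun N _ _ => ∀ [Module R N] [IsScalarTower R S N], 𝒬 N) := by
  intro I N _ _ h
  let _ (i : I) : Module R (N i) := Module.compHom (N i) (algebraMap R S)
  have (i : I) : IsScalarTower R S (N i) := IsScalarTower.of_compHom R S (N i)
  rw [injective_iff_map_eq_zero]
  intro x hx
  apply (baseChangeTensorEquiv R S M (∀ i, N i)).injective
  rw [map_zero]
  refine (injective_iff_map_eq_zero _).1 (hM I N fun i => h i) _ (funext fun i => ?_)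
  have hS : LinearMap.proj i ∘ₗ piRightHom S S (S ⊗[R] M) N =
      (LinearMap.proj i : (∀ i, N i) →ₗ[S] N i).lTensor (S ⊗[R] M) :=
    TensorProduct.ext' fun _ _ => rfl
  have hR : LinearMap.proj i ∘ₗ piRightHom R R M N =
      ((LinearMap.proj i : (∀ i, N i) →ₗ[S] N i).restrictScalars R).lTensor M :=
    TensorProduct.ext' fun _ _ => rfl
  refine (LinearMap.congr_fun hR _).trans ?_
  rw [← baseChangeTensorEquiv_lTensor, ← hS, LinearMap.comp_apply, hx, map_zero, map_zero]
  rfl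

end BaseChange

/-- Let `φ : R → S` be flat, `𝒞_R` a class of `R`-modules and `𝒞_S` a class
of `S`-modules with `𝒞_R ⊗[R] S ⊆ 𝒞_S`. If `M` is a flat `Def(𝒞_R^⊺)`-Mittag-Leffler
`R`-module, then `M ⊗[R] S` is a flat `Def(𝒞_S^⊺)`-Mittag-Leffler `S`-module. -/
theorem stmt_10 (R S : Type u) [CommRing R] [CommRing S] [Algebra R S] [Module.Flat R S]
    (𝒞R : (N : Type u) → [AddCommGroup N] → [Module R N] → Prop)
    (𝒞S : (N : Type u) → [AddCommGroup N] → [Module S N] → Prop)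
    (hC1 : ∀ (C : Type u) [AddCommGroup C] [Module R C], 𝒞R C → 𝒞S (S ⊗[R] C))
    (M : Type u) [AddCommGroup M] [Module R M]
    (hflat : Module.Flat R M)
    (hml : IsRelMittagLeffler R M (DefClosure R (TorPerp R 𝒞R))) :
    Module.Flat S (S ⊗[R] M) ∧
      IsRelMittagLeffler S (S ⊗[R] M) (DefClosure S (TorPerp S 𝒞S)) := by
  refine ⟨inferInstance, fun I N _ _ hN => hml.baseChange I N fun i _ _ 𝒞 h𝒞 hQ => ?_⟩
  refine hN i _ h𝒞.restrictScalars fun Q _ _ hQS _ _ => hQ Q fun C _ _ hC => ?_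
  exact (hQS (S ⊗[R] C) (hC1 C hC)).of_baseChange

end
end

section
/- Let φ : R → S be a flat homomorphism of commutative rings. If M is an f-projective R-module, then M ⊗_R S is an f-projective S-module. -/
open TensorProduct CategoryTheory

universe u

noncomputable section

/-- If `M` is f-projective, every finite family `m` in `M` has a factorization `m = a y` through a
finite family `y` such that every relation on `m` is already a relation on the rows of the
matrix `a`. -/
theorem IsFProjective.exists_factorization {A : Type u} [CommRing A] {M : Type u} [AddCommGroup M]
    [Module A M] (h : IsFProjective A M) {n : ℕ} (m : Fin n → M) :
    ∃ (k : ℕ) (a : Fin n → Fin k → A) (y : Fin k → M),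
      (∀ j, m j = ∑ l, a j l • y l) ∧
      ∀ r : Fin n → A, ∑ j, r j • m j = 0 → ∀ l, ∑ j, a j l * r j = 0 := by
  obtain ⟨_, hML⟩ := h
  let K := {k : Fin n → A // ∑ j, k j • m j = 0}
  let x : Fin n → K → A := fun j k => k.1 j
  have hz : ∑ j, m j ⊗ₜ[A] x j = 0 := by
    apply hML K (fun _ => A) fun _ => ⟨LinearEquiv.refl A A⟩
    ext k
    apply (TensorProduct.rid A M).injective
    simpa [x, Finset.sum_apply] using k.2
  have hz' : ∑ j, x j ⊗ₜ[A] m j = 0 := by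
    simpa using congrArg (TensorProduct.comm A M (K → A)) hz
  obtain ⟨k, a, y, hy, ha⟩ :=
    TensorProduct.vanishesTrivially_of_sum_tmul_eq_zero_of_rTensor_injective A
      (Module.Flat.rTensor_preserves_injective_linearMap _ (Submodule.subtype_injective _)) hz'
  refine ⟨k, a, y, hy, fun r hr l => ?_⟩
  simpa [x] using congrFun (ha l) ⟨r, hr⟩

/-- Every element of `(S ⊗[R] M) ⊗[S] P` is a finite sum of tensors `(1 ⊗ m) ⊗ p`. -/
theorem TensorProduct.exists_sum_one_tmul_tmul {R S : Type*} [CommRing R] [CommRing S]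
    [Algebra R S] {M P : Type*} [AddCommGroup M] [Module R M] [AddCommGroup P] [Module S P]
    (x : (S ⊗[R] M) ⊗[S] P) :
    ∃ (n : ℕ) (m : Fin n → M) (p : Fin n → P),
      x = ∑ j, ((1 : S) ⊗ₜ[R] m j) ⊗ₜ[S] p j := by
  have sum_closed {x y : (S ⊗[R] M) ⊗[S] P}
      (hx : ∃ (n : ℕ) (m : Fin n → M) (p : Fin n → P),
        x = ∑ j, ((1 : S) ⊗ₜ[R] m j) ⊗ₜ[S] p j)
      (hy : ∃ (n : ℕ) (m : Fin n → M) (p : Fin n → P),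
        y = ∑ j, ((1 : S) ⊗ₜ[R] m j) ⊗ₜ[S] p j) :
      ∃ (n : ℕ) (m : Fin n → M) (p : Fin n → P),
        x + y = ∑ j, ((1 : S) ⊗ₜ[R] m j) ⊗ₜ[S] p j := by
    obtain ⟨n, m, p, rfl⟩ := hx
    obtain ⟨n', m', p', rfl⟩ := hy
    exact ⟨n + n', Fin.append m m', Fin.append p p', by simp [Fin.sum_univ_add]⟩
  induction x with
  | zero => exact ⟨0, Fin.elim0, Fin.elim0, by simp⟩
  | add x y hx hy => exact sum_closed hx hy
  | tmul t p =>
    induction t with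
    | zero => exact ⟨0, Fin.elim0, Fin.elim0, by simp⟩
    | add t t' ht ht' => simpa only [TensorProduct.add_tmul] using sum_closed ht ht'
    | tmul s m =>
      refine ⟨1, fun _ => m, fun _ => s • p, ?_⟩
      simp [TensorProduct.smul_tmul']

/-- Let `φ : R → S` be a flat homomorphism of commutative rings. If `M` is an
f-projective `R`-module, then `M ⊗[R] S` is an f-projective `S`-module. -/
theorem stmt_12 (R S : Type u) [CommRing R] [CommRing S] [Algebra R S] [Module.Flat R S]
    (M : Type u) [AddCommGroup M] [Module R M]
    (h : IsFProjective R M) :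
    IsFProjective S (S ⊗[R] M) := by
  have := h.1
  refine ⟨inferInstance, fun I N _ _ hN => ?_⟩
  rw [injective_iff_map_eq_zero]
  intro x hx
  obtain ⟨n, m, p, rfl⟩ := TensorProduct.exists_sum_one_tmul_tmul x
  obtain ⟨k, a, y, hy, ha⟩ := h.exists_factorization m
  have key (l : Fin k) : ∑ j, algebraMap R S (a j l) • p j = 0 := by
    ext i
    obtain ⟨e⟩ := hN i
    have h₀ : ∑ j, m j ⊗ₜ[R] e (p j i) = 0 := by
      have h₁ := congrFun hx i
      have h₂ := congrArg (TensorProduct.comm R S M ∘ TensorProduct.rid S (S ⊗[R] M) ∘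
        TensorProduct.congr (LinearEquiv.refl S (S ⊗[R] M)) e) h₁
      simpa [TensorProduct.smul_tmul', Finset.sum_apply] using h₂
    obtain ⟨d, b, t, ht, hb⟩ :=
      TensorProduct.vanishesTrivially_of_sum_tmul_eq_zero_of_rTensor_injective R
        (Module.Flat.rTensor_preserves_injective_linearMap _ (Submodule.subtype_injective _)) h₀
    apply e.injective
    calc e ((∑ j, algebraMap R S (a j l) • p j) i)
        = ∑ j, a j l • e (p j i) := by simp [Finset.sum_apply, Algebra.smul_def]
      _ = ∑ q, (∑ j, a j l * b j q) • t q := by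
        simp_rw [ht, Finset.smul_sum, Finset.sum_smul, mul_smul]
        exact Finset.sum_comm
      _ = e 0 := by simp [fun q => ha _ (hb q) l]
  calc ∑ j, ((1 : S) ⊗ₜ[R] m j) ⊗ₜ[S] p j
      = ∑ l, ((1 : S) ⊗ₜ[R] y l) ⊗ₜ[S] ∑ j, algebraMap R S (a j l) • p j := by
        simp_rw [hy, TensorProduct.tmul_sum, TensorProduct.sum_tmul]
        rw [Finset.sum_comm]
        refine Finset.sum_congr rfl fun l _ => Finset.sum_congr rfl fun j _ => ?_
        rw [TensorProduct.tmul_smul, TensorProduct.tmul_smul, TensorProduct.smul_tmul',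
          algebraMap_smul, TensorProduct.smul_tmul', TensorProduct.smul_tmul']
    _ = 0 := by simp [key]

end
end
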